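/- arXiv:2308.10245 — 6 statements merged into one kernel-verified Lean document; each statement's English description precedes it below -/
import Mathlib

section
/- Let K ≥ 1 be a real number and let A be a nonempty finite subset of an abelian group with additive energy E(A) ≥ |A|³/K. Then there exists a subset A' ⊆ A with |A'| ≥ c·|A|/K for some absolute constant c > 0, such that |A' − A'| ≤ C·K⁴·|A'| for some absolute constant C. -/
open Finset Pointwise

/-- The additive energy of `A`: the number of quadruples
`(a₁, a₂, a₃, a₄) ∈ A⁴` with `a₁ + a₂ = a₃ + a₄`. -/
def addEnergyOf {G : Type*} [AddCommGroup G] [DecidableEq G] (A : Finset G) : ℕ :=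
  (((A ×ˢ A) ×ˢ A ×ˢ A).filter fun q => q.1.1 + q.1.2 = q.2.1 + q.2.2).card

/-- Elements of `A` lying in `A + s`. -/
def bsgX {G : Type*} [AddCommGroup G] [DecidableEq G] (A : Finset G) (s : G) : Finset G :=
  A.filter fun a => a - s ∈ A

theorem bsg_sum_one {G : Type*} [AddCommGroup G] [DecidableEq G] (A : Finset G) :
    ∑ s ∈ A - A, (bsgX A s).card ≤ A.card ^ 2 := by
  rw [← Finset.card_sigma, sq, ← Finset.card_product]
  refine Finset.card_le_card_of_injOn (fun p => (p.2, p.2 - p.1)) ?_ ?_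
  · rintro ⟨s, a⟩ h
    simp [bsgX] at h ⊢
    exact h.2
  · rintro ⟨s, a⟩ h ⟨t, b⟩ h' hh
    simp at hh
    obtain ⟨rfl, h2⟩ := hh
    simp at h2
    simp [h2]

theorem bsg_energy {G : Type*} [AddCommGroup G] [DecidableEq G] (A : Finset G) :
    addEnergyOf A ≤ ∑ s ∈ A - A, (bsgX A s).card ^ 2 := by
  have : ∑ s ∈ A - A, (bsgX A s).card ^ 2
      = ((A - A).sigma fun s => bsgX A s ×ˢ bsgX A s).card := by
    rw [Finset.card_sigma]
    simp [sq]
  rw [this, addEnergyOf]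
  refine Finset.card_le_card_of_injOn
    (fun q => ⟨q.1.1 - q.2.1, (q.1.1, q.2.2)⟩) ?_ ?_
  · rintro ⟨⟨a, b⟩, c, d⟩ h
    simp only [Finset.coe_filter, Finset.mem_product, Set.mem_ofPred_eq] at h
    obtain ⟨⟨⟨ha, hb⟩, hc, hd⟩, he⟩ := h
    have h1 : d - (a - c) = b := by
      rw [sub_sub_eq_add_sub, sub_eq_iff_eq_add, add_comm d c, ← he, add_comm]
    simp only [Finset.coe_sigma, Set.mem_sigma_iff, Finset.mem_coe, Finset.mem_product, bsgX,
      Finset.mem_filter, h1]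
    refine ⟨Finset.sub_mem_sub ha hc, ⟨ha, ?_⟩, hd, hb⟩
    simpa using hc
  · rintro ⟨⟨a, b⟩, c, d⟩ h ⟨⟨a', b'⟩, c', d'⟩ h' hh
    simp only [Finset.coe_filter, Finset.mem_product, Set.mem_ofPred_eq] at h h'
    simp only [Sigma.mk.injEq, heq_eq_eq, Prod.mk.injEq] at hh
    obtain ⟨h1, rfl, rfl⟩ := hh
    have hc : c = c' := by simpa using h1
    subst hc
    have hb : b = b' := by
      have := h.2.trans h'.2.symm
      simpa using this
    subst hb
    rfl

open Classical in
theorem bsg_bad {G : Type*} [AddCommGroup G] [DecidableEq G] (A : Finset G) (T : ℝ) :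
    ∑ s ∈ A - A, ((bsgX A s ×ˢ bsgX A s).filter
        fun p => ((bsgX A (p.1 - p.2)).card : ℝ) ≤ T).card
      ≤ ∑ x ∈ (A - A).filter (fun x => ((bsgX A x).card : ℝ) ≤ T), (bsgX A x).card ^ 2 := by
  have : ∑ x ∈ (A - A).filter (fun x => ((bsgX A x).card : ℝ) ≤ T), (bsgX A x).card ^ 2
      = (((A - A).filter (fun x => ((bsgX A x).card : ℝ) ≤ T)).sigma
          fun s => bsgX A s ×ˢ bsgX A s).card := by
    rw [Finset.card_sigma]
    simp [sq]
  rw [this, ← Finset.card_sigma]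
  refine Finset.card_le_card_of_injOn
    (fun q => ⟨q.2.1 - q.2.2, (q.2.1, q.2.1 - q.1)⟩) ?_ ?_
  · rintro ⟨s, a, b⟩ h
    simp only [Finset.coe_sigma, Set.mem_sigma_iff, Finset.mem_coe, Finset.mem_product,
      Finset.mem_filter] at h ⊢
    obtain ⟨hs, ⟨ha, hb⟩, hT⟩ := h
    have ha' := ha
    have hb' := hb
    simp only [bsgX, Finset.mem_filter] at ha' hb'
    refine ⟨⟨Finset.sub_mem_sub ha'.1 hb'.1, hT⟩, ?_, ?_⟩
    · simp only [bsgX, Finset.mem_filter]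
      refine ⟨ha'.1, ?_⟩
      simpa using hb'.1
    · simp only [bsgX, Finset.mem_filter]
      refine ⟨ha'.2, ?_⟩
      have : a - s - (a - b) = b - s := by abel
      rw [this]
      exact hb'.2
  · rintro ⟨s, a, b⟩ h ⟨s', a', b'⟩ h' hh
    simp only [Sigma.mk.injEq, heq_eq_eq, Prod.mk.injEq] at hh
    obtain ⟨h1, rfl, h2⟩ := hh
    have e1 : b = b' := by simpa using h1
    have e2 : s = s' := by simpa using h2
    subst e1 e2
    rfl

theorem bsg_fiber {G : Type*} [AddCommGroup G] [DecidableEq G] (P S : Finset G) (m : ℝ)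
    (h : ∀ d ∈ S, m ≤ (((P ×ˢ P).filter fun p => p.1 - p.2 = d).card : ℝ)) :
    S.card * m ≤ (P.card : ℝ) ^ 2 := by
  have h1 : ∑ d ∈ S, ((P ×ˢ P).filter fun p => p.1 - p.2 = d).card ≤ P.card ^ 2 := by
    rw [← Finset.card_sigma, sq, ← Finset.card_product]
    refine Finset.card_le_card_of_injOn (fun p => p.2) ?_ ?_
    · rintro ⟨s, a⟩ h
      simp only [Finset.coe_sigma, Set.mem_sigma_iff, Finset.mem_coe, Finset.mem_filter] at h
      exact h.2.1
    · rintro ⟨s, a⟩ h ⟨t, b⟩ h' hh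
      simp only [Finset.coe_sigma, Set.mem_sigma_iff, Finset.mem_coe, Finset.mem_filter] at h h'
      simp only at hh
      subst hh
      have : s = t := h.2.2.symm.trans h'.2.2
      subst this
      rfl
  have h2 : ∑ d ∈ S, m ≤ ∑ d ∈ S, (((P ×ˢ P).filter fun p => p.1 - p.2 = d).card : ℝ) :=
    Finset.sum_le_sum h
  rw [Finset.sum_const, nsmul_eq_mul] at h2
  refine h2.trans ?_
  exact_mod_cast h1

open Classical in
/-- Graph part: few bad pairs gives half of the vertices with few bad neighbours. -/
theorem bsg_markov {G : Type*} (X : Finset G) (R : G → G → Prop)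
    (h : 8 * (((X ×ˢ X).filter fun p => R p.1 p.2).card : ℝ) ≤ (X.card : ℝ) ^ 2) :
    (X.card : ℝ) / 2 ≤
      ((X.filter fun a => ((X.filter fun c => R a c).card : ℝ) ≤ X.card / 4).card : ℝ) := by
  have h1 : ((X ×ˢ X).filter fun p => R p.1 p.2).card
      = ∑ a ∈ X, (X.filter fun c => R a c).card := by
    simp only [Finset.card_filter, Finset.sum_product]
  have h1' : (((X ×ˢ X).filter fun p => R p.1 p.2).card : ℝ)
      = ∑ a ∈ X, ((X.filter fun c => R a c).card : ℝ) := by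
    exact_mod_cast h1
  set Q : G → Prop := fun a => ((X.filter fun c => R a c).card : ℝ) ≤ X.card / 4 with hQ
  have h2 : ((X.filter fun a => ¬ Q a).card : ℝ) * (X.card / 4)
      ≤ ∑ a ∈ X, ((X.filter fun c => R a c).card : ℝ) := by
    rw [← nsmul_eq_mul, ← Finset.sum_const]
    refine (Finset.sum_le_sum (g := fun a => ((X.filter fun c => R a c).card : ℝ)) ?_).trans
      (Finset.sum_le_sum_of_subset_of_nonneg (Finset.filter_subset _ _) ?_)
    · intro a ha
      simp only [Finset.mem_filter, hQ, not_le] at ha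
      exact ha.2.le
    · intros
      positivity
  have h3 : ((X.filter Q).card : ℝ) + ((X.filter fun a => ¬ Q a).card : ℝ) = X.card := by
    exact_mod_cast Finset.card_filter_add_card_filter_not (s := X) Q
  rw [← h1'] at h2
  rcases Nat.eq_zero_or_pos X.card with h0 | h0
  · rw [h0]
    simp
  · have h0' : (0 : ℝ) < X.card := by exact_mod_cast h0
    have : ((X.filter fun a => ¬ Q a).card : ℝ) ≤ X.card / 2 := by
      by_contra hc
      push Not at hc
      nlinarith
    linarith

theorem bsg_theorem :
    ∃ c C : ℝ, 0 < c ∧ 0 < C ∧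
      ∀ (G : Type*) [AddCommGroup G] [DecidableEq G] (A : Finset G) (K : ℝ),
        1 ≤ K → A.Nonempty → (A.card : ℝ) ^ 3 / K ≤ (addEnergyOf A : ℝ) →
        ∃ A' ⊆ A, c * A.card / K ≤ (A'.card : ℝ) ∧
          ((A' - A').card : ℝ) ≤ C * K ^ 4 * A'.card := by
  classical
  refine ⟨1 / 4, 16384, by norm_num, by norm_num, ?_⟩
  intro G _ _ A K hK hA hE
  have hn : (0 : ℝ) < A.card := by exact_mod_cast hA.card_pos
  have hK0 : (0 : ℝ) < K := by linarith
  set n : ℝ := (A.card : ℝ) with hnn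
  obtain ⟨L, hL⟩ : ∃ L : ℝ, L = n / K := ⟨_, rfl⟩
  have hLK : L * K = n := by rw [hL]; field_simp
  have hL0 : 0 < L := by rw [hL]; positivity
  set T : ℝ := L / 32 with hT
  set r : G → ℝ := fun s => ((bsgX A s).card : ℝ) with hr
  have hr0 : ∀ s, 0 ≤ r s := fun s => by positivity
  set bad : G → ℝ := fun s => (((bsgX A s ×ˢ bsgX A s).filter
        fun p => r (p.1 - p.2) ≤ T).card : ℝ) with hbad
  have s1 : ∑ s ∈ A - A, r s ≤ n ^ 2 := by
    have := bsg_sum_one A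
    simp only [hr, hnn]
    exact_mod_cast this
  have s2 : n ^ 2 * L ≤ ∑ s ∈ A - A, r s ^ 2 := by
    have h := bsg_energy A
    have h' : (addEnergyOf A : ℝ) ≤ ∑ s ∈ A - A, r s ^ 2 := by
      simp only [hr]
      exact_mod_cast h
    have : n ^ 3 / K = n ^ 2 * L := by rw [hL]; ring
    linarith
  have s3 : ∑ s ∈ A - A, bad s ≤ T * n ^ 2 := by
    have h := bsg_bad A T
    have h' : ∑ s ∈ A - A, bad s ≤ ∑ x ∈ (A - A).filter (fun x => r x ≤ T), r x ^ 2 := by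
      simp only [hr, hbad]
      exact_mod_cast h
    refine h'.trans ?_
    calc ∑ x ∈ (A - A).filter (fun x => r x ≤ T), r x ^ 2
        ≤ ∑ x ∈ (A - A).filter (fun x => r x ≤ T), T * r x := by
          refine Finset.sum_le_sum fun x hx => ?_
          rw [sq]
          exact mul_le_mul_of_nonneg_right (Finset.mem_filter.1 hx).2 (hr0 x)
      _ ≤ ∑ x ∈ A - A, T * r x :=
          Finset.sum_le_sum_of_subset_of_nonneg (Finset.filter_subset _ _)
            fun x _ _ => mul_nonneg (by positivity) (hr0 x)
      _ = T * ∑ x ∈ A - A, r x := by rw [Finset.mul_sum]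
      _ ≤ T * n ^ 2 := mul_le_mul_of_nonneg_left s1 (by positivity)
  have hex : ∃ s ∈ A - A, 8 * bad s + L / 2 * r s < r s ^ 2 := by
    apply Finset.exists_lt_of_sum_lt
    rw [Finset.sum_add_distrib, ← Finset.mul_sum, ← Finset.mul_sum]
    have h1 : L / 2 * ∑ s ∈ A - A, r s ≤ L / 2 * n ^ 2 :=
      mul_le_mul_of_nonneg_left s1 (by positivity)
    have h2 : 0 < L * n ^ 2 := by positivity
    rw [hT] at s3
    linarith
  obtain ⟨s, -, hs⟩ := hex
  have hb0 : 0 ≤ bad s := by positivity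
  have hrs : L / 2 < r s := by
    have h0 := hr0 s
    by_contra hc
    push Not at hc
    nlinarith
  have hmk := bsg_markov (bsgX A s) (fun a c => r (a - c) ≤ T) (by
    have : 0 ≤ L / 2 * r s := mul_nonneg (by positivity) (hr0 s)
    have h3 : 8 * bad s ≤ r s ^ 2 := by linarith
    exact h3)
  set X := bsgX A s with hX
  have hXA : X ⊆ A := Finset.filter_subset _ _
  set A' := X.filter fun a => ((X.filter fun c => r (a - c) ≤ T).card : ℝ) ≤ X.card / 4 with hA'
  have hXr : (X.card : ℝ) = r s := rfl
  rw [hXr] at hmk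
  set P := (A - A).filter fun x => T < r x with hP
  have hPc : P.card * T ≤ n ^ 2 := by
    rw [← nsmul_eq_mul, ← Finset.sum_const]
    calc ∑ x ∈ P, T ≤ ∑ x ∈ P, r x :=
          Finset.sum_le_sum fun x hx => (Finset.mem_filter.1 hx).2.le
      _ ≤ ∑ x ∈ A - A, r x :=
          Finset.sum_le_sum_of_subset_of_nonneg (Finset.filter_subset _ _) fun x _ _ => hr0 x
      _ ≤ n ^ 2 := s1
  have hfib := bsg_fiber P (A' - A') (r s / 2) (by
    intro d hd
    obtain ⟨a, ha, b, hb, rfl⟩ := Finset.mem_sub.1 hd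
    obtain ⟨haX, ha2⟩ := Finset.mem_filter.1 ha
    obtain ⟨hbX, hb2⟩ := Finset.mem_filter.1 hb
    set U := X.filter fun c => r (a - c) ≤ T
    set V := X.filter fun c => r (b - c) ≤ T
    have hc1 : X.card ≤ (X \ (U ∪ V)).card + (U.card + V.card) := by
      have e1 := Finset.le_card_sdiff (U ∪ V) X
      have e2 := Finset.card_union_le U V
      omega
    have hc2 : (X.card : ℝ) ≤ (X \ (U ∪ V)).card + (U.card + V.card) := by exact_mod_cast hc1
    have hc3 : (X \ (U ∪ V)).card ≤ ((P ×ˢ P).filter fun p => p.1 - p.2 = a - b).card := by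
      refine Finset.card_le_card_of_injOn (fun c => (a - c, b - c)) ?_ ?_
      · intro c hc
        simp only [U, V, Finset.mem_coe, Finset.mem_sdiff, Finset.mem_union, Finset.mem_filter,
          not_or, not_and, not_le] at hc
        obtain ⟨hcX, hU, hV⟩ := hc
        simp only [Finset.mem_coe, Finset.mem_filter, Finset.mem_product, hP]
        exact ⟨⟨⟨Finset.sub_mem_sub (hXA haX) (hXA hcX), hU hcX⟩,
          Finset.sub_mem_sub (hXA hbX) (hXA hcX), hV hcX⟩, by abel⟩
      · intro c _ c' _ hh
        simpa using (Prod.mk.inj hh).1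
    have hc4 : ((X \ (U ∪ V)).card : ℝ)
      ≤ ((P ×ˢ P).filter fun p => p.1 - p.2 = a - b).card := by exact_mod_cast hc3
    rw [← hXr]
    linarith)
  refine ⟨A', (Finset.filter_subset _ _).trans hXA, ?_, ?_⟩
  · have : 1 / 4 * n / K = L / 4 := by rw [hL]; ring
    rw [this]
    linarith
  · have hP2 : (P.card : ℝ) ≤ 32 * n * K := by
      have e : (32 * n * K) * T = n ^ 2 := by
        rw [hT]; linear_combination n * hLK
      exact le_of_mul_le_mul_right (by rw [e]; exact hPc) (by positivity : 0 < T)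
    have hP3 : (P.card : ℝ) ^ 2 ≤ (32 * n * K) ^ 2 :=
      pow_le_pow_left₀ (by positivity) hP2 2
    have hrp : 0 < r s := by linarith
    have hLr : L ^ 2 ≤ (2 * r s) ^ 2 := pow_le_pow_left₀ hL0.le (by linarith) 2
    have h5 : (32 * n * K) ^ 2 ≤ 16384 * K ^ 4 * (r s / 2) * (r s / 2) := by
      have e : (32 * n * K) ^ 2 = 1024 * K ^ 4 * L ^ 2 := by rw [← hLK]; ring
      rw [e]
      have := mul_le_mul_of_nonneg_left hLr (by positivity : 0 ≤ 1024 * K ^ 4)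
      linarith
    have h6 : ((A' - A').card : ℝ) ≤ 16384 * K ^ 4 * (r s / 2) :=
      le_of_mul_le_mul_right (hfib.trans (hP3.trans h5)) (by positivity : 0 < r s / 2)
    exact h6.trans (mul_le_mul_of_nonneg_left hmk (by positivity))
end

section
/- Let K ≥ 1 and ε ∈ (0, 1/2) be real numbers and let A be a nonempty finite subset of an abelian group with additive energy E(A) ≥ |A|³/K. Then there exists a subset A' ⊆ A such that |A'| ≥ (1 − ε)·K^{−1/2}·|A| and |A' − A'| ≤ 2³³·ε^{−9}·K⁴·|A'|. -/
open Finset Pointwise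

/-- number of representations of `x` as a difference in `A`. -/
def cntRep {G : Type*} [AddCommGroup G] [DecidableEq G] (A Q : Finset G) (x : G) : Finset G :=
  A.filter fun b => b - x ∈ Q

lemma energy_eq {G : Type*} [AddCommGroup G] [DecidableEq G] (A : Finset G) :
    addEnergyOf A = ∑ x ∈ A - A, (cntRep A A x).card ^ 2 := by
  unfold addEnergyOf
  rw [card_eq_sum_card_fiberwise (f := fun q => q.1.1 - q.2.1) (t := A - A)]
  · refine sum_congr rfl fun x hx => ?_
    rw [sq, ← card_product]
    refine card_bij' (fun q _ => (q.1.1, q.2.2)) (fun p _ => ((p.1, p.2 - x), (p.1 - x, p.2)))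
      ?_ ?_ ?_ ?_
    · rintro ⟨⟨a, b⟩, c, d⟩ h
      simp only [mem_filter, mem_product, cntRep] at h ⊢
      obtain ⟨⟨⟨⟨h1, h2⟩, h3, h4⟩, h5⟩, h6⟩ := h
      have e1 : a - x = c := by rw [← h6]; abel
      have e2 : d - x = b := by
        have : d = a + b - c := by rw [h5]; abel
        rw [← h6, this]; abel
      rw [e1, e2]; exact ⟨⟨h1, h3⟩, h4, h2⟩
    · rintro ⟨a, d⟩ h
      simp only [mem_filter, mem_product, cntRep] at h ⊢
      obtain ⟨⟨h1, h2⟩, h3, h4⟩ := h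
      exact ⟨⟨⟨⟨h1, h4⟩, h2, h3⟩, by abel⟩, by abel⟩
    · rintro ⟨⟨a, b⟩, c, d⟩ h
      simp only [mem_filter, mem_product] at h ⊢
      obtain ⟨⟨⟨⟨h1, h2⟩, h3, h4⟩, h5⟩, h6⟩ := h
      have e1 : a - x = c := by rw [← h6]; abel
      have e2 : d - x = b := by
        have : d = a + b - c := by rw [h5]; abel
        rw [← h6, this]; abel
      rw [e1, e2]
    · rintro ⟨a, d⟩ h
      rfl
  · rintro ⟨⟨a, b⟩, c, d⟩ h
    simp only [coe_filter, mem_product, Set.mem_ofPred_eq] at h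
    exact sub_mem_sub h.1.1.1 h.1.2.1

lemma sum_cnt {G : Type*} [AddCommGroup G] [DecidableEq G] (A P : Finset G) :
    ∑ u ∈ A, (cntRep A P u).card = ∑ x ∈ P, (cntRep A A x).card := by
  simp only [cntRep]
  have h := fun (S T : Finset G) => sum_card_bipartiteAbove_eq_sum_card_bipartiteBelow
    (s := S) (t := T) (fun u b => b - u ∈ P)
  have h' := sum_card_bipartiteAbove_eq_sum_card_bipartiteBelow
    (s := P) (t := A) (fun x b => b - x ∈ A)
  simp only [bipartiteAbove, bipartiteBelow] at h h'
  rw [h A A, h']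
  refine sum_congr rfl fun b _ => ?_
  refine card_bij' (fun u _ => b - u) (fun x _ => b - x) ?_ ?_ ?_ ?_ <;> simp +contextual

lemma prune {G : Type*} [DecidableEq G] (X : Finset G) (R : G → G → Prop)
    [DecidableRel R] (hR : ∀ a b, R a b → R b a) (δ : ℝ)
    (hbad : (((X ×ˢ X).filter fun q => ¬ R q.1 q.2).card : ℝ) ≤ δ * (X.card : ℝ) ^ 2) :
    ∃ A' ⊆ X, (1 - 4 * δ) * X.card ≤ (A'.card : ℝ) ∧
      ∀ b ∈ A', ∀ c ∈ A', (X.card : ℝ) / 2 ≤ ((X.filter fun d => R b d ∧ R d c).card : ℝ) := by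
  rcases X.eq_empty_or_nonempty with rfl | hX
  · exact ⟨∅, by simp, by simp, by simp⟩
  have hXpos : (0 : ℝ) < X.card := by exact_mod_cast hX.card_pos
  let B : G → Finset G := fun b => X.filter fun d => ¬ R b d
  refine ⟨X.filter fun b => 4 * (B b).card ≤ X.card, filter_subset _ _, ?_, ?_⟩
  · have hsum : ((X ×ˢ X).filter fun q => ¬ R q.1 q.2).card = ∑ b ∈ X, (B b).card := by
      rw [card_filter, sum_product]
      exact sum_congr rfl fun b _ => by simp only [B, card_filter]
    have h1 : ((X.filter fun b => ¬ 4 * (B b).card ≤ X.card).card : ℝ) * (X.card / 4)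
        ≤ ∑ b ∈ X, ((B b).card : ℝ) := by
      calc _ = ∑ b ∈ X.filter (fun b => ¬ 4 * (B b).card ≤ X.card), ((X.card : ℝ) / 4) := by simp
        _ ≤ ∑ b ∈ X.filter (fun b => ¬ 4 * (B b).card ≤ X.card), ((B b).card : ℝ) := by
            refine sum_le_sum fun b hb => ?_
            have := (mem_filter.1 hb).2
            push Not at this
            have : (X.card : ℝ) < 4 * (B b).card := by exact_mod_cast this
            linarith
        _ ≤ _ := sum_le_sum_of_subset_of_nonneg (filter_subset _ _) (by intros; positivity)
    have h2 : ((X.filter fun b => 4 * (B b).card ≤ X.card).card : ℝ)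
      + (X.filter fun b => ¬ 4 * (B b).card ≤ X.card).card = X.card := by
      exact_mod_cast card_filter_add_card_filter_not _
    rw [hsum] at hbad
    push_cast at hbad
    have h3 : ((X.filter fun b => ¬ 4 * (B b).card ≤ X.card).card : ℝ) ≤ 4 * δ * X.card := by
      have := h1.trans hbad
      by_contra hc
      have hc := not_le.1 hc
      nlinarith
    linarith
  · intro b hb c hc
    have hb := (mem_filter.1 hb).2
    have hc := (mem_filter.1 hc).2
    have : X ⊆ (X.filter fun d => R b d ∧ R d c) ∪ (B b ∪ B c) := by
      intro d hd
      simp only [B, mem_union, mem_filter, hd, true_and]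
      by_cases h1 : R b d
      · by_cases h2 : R c d
        · exact Or.inl ⟨h1, hR _ _ h2⟩
        · exact Or.inr (Or.inr h2)
      · exact Or.inr (Or.inl h1)
    have h4 := card_le_card this
    have h5 := card_union_le (X.filter fun d => R b d ∧ R d c) (B b ∪ B c)
    have h6 := card_union_le (B b) (B c)
    have : X.card ≤ 2 * (X.filter fun d => R b d ∧ R d c).card := by omega
    have : (X.card : ℝ) ≤ 2 * (X.filter fun d => R b d ∧ R d c).card := by exact_mod_cast this
    linarith

/-- common neighbours -/
def coN {G : Type*} [AddCommGroup G] [DecidableEq G] (V Q : Finset G) (b d : G) : Finset G :=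
  V.filter fun u => b - u ∈ Q ∧ d - u ∈ Q

lemma rep_count {G : Type*} [AddCommGroup G] [DecidableEq G] (V Q X A' : Finset G) (τ : ℝ)
    (hτ : 0 < τ)
    (h : ∀ b ∈ A', ∀ c ∈ A', (X.card : ℝ) / 2 ≤
      ((X.filter fun d => τ ≤ (coN V Q b d).card ∧ τ ≤ (coN V Q d c).card).card : ℝ)) :
    ((A' - A').card : ℝ) * X.card * τ ^ 2 ≤ 2 * (Q.card : ℝ) ^ 4 := by
  classical
  have hch : ∀ e : G, ∃ p : G × G, e ∈ A' - A' → p.1 ∈ A' ∧ p.2 ∈ A' ∧ p.1 - p.2 = e := by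
    intro e
    by_cases he : e ∈ A' - A'
    · obtain ⟨b, hb, c, hc, h⟩ := mem_sub.1 he
      exact ⟨(b, c), fun _ => ⟨hb, hc, h⟩⟩
    · exact ⟨(e, e), fun h => absurd h he⟩
  choose p hp using hch
  let F : G → Finset (Σ _ : G, G × G) := fun e =>
    (X.filter fun d => τ ≤ (coN V Q (p e).1 d).card ∧ τ ≤ (coN V Q d (p e).2).card).sigma
      fun d => coN V Q (p e).1 d ×ˢ coN V Q d (p e).2
  have hF : ∀ e ∈ A' - A', (X.card : ℝ) / 2 * τ ^ 2 ≤ ((F e).card : ℝ) := by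
    intro e he
    obtain ⟨h1, h2, h3⟩ := hp e he
    have h4 := h _ h1 _ h2
    simp only [F, card_sigma, card_product]
    push_cast
    calc (X.card : ℝ) / 2 * τ ^ 2 ≤ _ := mul_le_mul_of_nonneg_right h4 (by positivity)
      _ = ∑ d ∈ (X.filter fun d => τ ≤ (coN V Q (p e).1 d).card ∧ τ ≤ (coN V Q d (p e).2).card),
          τ ^ 2 := by simp
      _ ≤ _ := by
        refine sum_le_sum fun d hd => ?_
        obtain ⟨h5, h6⟩ := (mem_filter.1 hd).2
        rw [sq]
        exact mul_le_mul h5 h6 hτ.le (by positivity)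
  have hinj : ((A' - A').sigma F).card ≤ ((Q ×ˢ Q) ×ˢ (Q ×ˢ Q)).card := by
    refine card_le_card_of_injOn (fun z => (((p z.1).1 - z.2.2.1, z.2.1 - z.2.2.1),
      (z.2.1 - z.2.2.2, (p z.1).2 - z.2.2.2))) ?_ ?_
    · rintro ⟨e, d, u, v⟩ hz
      simp only [F, coN, coe_sigma, Set.mem_sigma_iff, mem_coe, mem_sigma, mem_filter, mem_product]
        at hz ⊢
      tauto
    · rintro ⟨e, d, u, v⟩ hz ⟨e', d', u', v'⟩ hz' heq
      simp only [coe_sigma, Set.mem_sigma_iff, mem_coe] at hz hz'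
      simp only [Prod.mk.injEq] at heq
      obtain ⟨⟨q1, q2⟩, q3, q4⟩ := heq
      obtain ⟨-, -, k⟩ := hp e hz.1
      obtain ⟨-, -, k'⟩ := hp e' hz'.1
      have he : e = e' := by
        rw [← k, ← k']
        calc (p e).1 - (p e).2 = ((p e).1 - u) - (d - u) + (d - v) - ((p e).2 - v) := by abel
          _ = ((p e').1 - u') - (d' - u') + (d' - v') - ((p e').2 - v') := by rw [q1, q2, q3, q4]
          _ = _ := by abel
      subst he
      have hu : u = u' := sub_right_injective q1
      subst hu
      have hd : d = d' := sub_left_injective q2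
      subst hd
      have hv : v = v' := sub_right_injective q3
      subst hv
      rfl
  have h7 : ((A' - A').card : ℝ) * (X.card / 2 * τ ^ 2) ≤ (((A' - A').sigma F).card : ℝ) := by
    rw [card_sigma]; push_cast
    rw [← nsmul_eq_mul]
    exact card_nsmul_le_sum _ _ _ hF
  have h8 : (((A' - A').sigma F).card : ℝ) ≤ (Q.card : ℝ) ^ 4 := by
    have : (((A' - A').sigma F).card : ℝ) ≤ (((Q ×ˢ Q) ×ˢ (Q ×ˢ Q)).card : ℝ) := by
      exact_mod_cast hinj
    refine this.trans (le_of_eq ?_)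
    simp only [card_product]; push_cast; ring
  nlinarith

lemma main_lemma {G : Type*} [AddCommGroup G] [DecidableEq G] (A Q V : Finset G) (τ δ m : ℝ)
    (hA : A.Nonempty) (hτ : 0 < τ) (hδ : 0 < δ) (hm : 0 ≤ m)
    (hS : τ * (A.card : ℝ) ^ 2 / δ + V.card * m ^ 2 ≤ ∑ u ∈ V, ((cntRep A Q u).card : ℝ) ^ 2) :
    ∃ u ∈ V, ∃ A' ⊆ A, m ≤ (cntRep A Q u).card ∧
      (1 - 4 * δ) * (cntRep A Q u).card ≤ (A'.card : ℝ) ∧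
      ((A' - A').card : ℝ) * (cntRep A Q u).card * τ ^ 2 ≤ 2 * (Q.card : ℝ) ^ 4 := by
  classical
  have hApos : (0 : ℝ) < A.card := by exact_mod_cast hA.card_pos
  let R : G → G → Prop := fun b d => τ ≤ (coN V Q b d).card
  have hR : ∀ a b, R a b → R b a := by
    intro a b h
    have : coN V Q b a = coN V Q a b := by
      unfold coN; exact filter_congr fun u _ => and_comm
    simp only [R, this]; exact h
  let bad : G → Finset (G × G) := fun u =>
    (cntRep A Q u ×ˢ cntRep A Q u).filter fun q => ¬ R q.1 q.2
  have hbad : ∑ u ∈ V, ((bad u).card : ℝ) ≤ τ * (A.card : ℝ) ^ 2 := by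
    have h1 := sum_card_bipartiteAbove_eq_sum_card_bipartiteBelow
      (s := V) (t := (A ×ˢ A).filter fun q => ¬ R q.1 q.2)
      (fun u q => q.1 - u ∈ Q ∧ q.2 - u ∈ Q)
    have h2 : ∀ u ∈ V, (bad u).card = (bipartiteAbove (fun u (q : G × G) => q.1 - u ∈ Q ∧ q.2 - u ∈ Q)
        ((A ×ˢ A).filter fun q => ¬ R q.1 q.2) u).card := by
      intro u _
      congr 1
      ext q
      simp only [bad, cntRep, bipartiteAbove, mem_filter, mem_product]
      tauto
    have h3 : ∑ u ∈ V, ((bad u).card : ℝ) = ∑ q ∈ (A ×ˢ A).filter (fun q => ¬ R q.1 q.2),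
        ((coN V Q q.1 q.2).card : ℝ) := by
      exact_mod_cast (sum_congr rfl h2).trans h1
    rw [h3]
    calc _ ≤ ∑ q ∈ (A ×ˢ A).filter (fun q => ¬ R q.1 q.2), τ := by
          refine sum_le_sum fun q hq => ?_
          exact (not_le.1 (mem_filter.1 hq).2).le
      _ ≤ ∑ q ∈ A ×ˢ A, τ := sum_le_sum_of_subset_of_nonneg (filter_subset _ _)
          (by intros; exact hτ.le)
      _ = _ := by simp [card_product]; ring
  have hV : V.Nonempty := by
    rw [nonempty_iff_ne_empty]
    rintro rfl
    simp only [card_empty, sum_empty] at hS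
    have : 0 < τ * (A.card : ℝ) ^ 2 / δ := by positivity
    simp at hS
    linarith
  have hex : ∃ u ∈ V, ((bad u).card : ℝ) / δ + m ^ 2 ≤ ((cntRep A Q u).card : ℝ) ^ 2 := by
    refine exists_le_of_sum_le hV (le_trans ?_ hS)
    rw [sum_add_distrib, ← sum_div]
    simp only [sum_const, nsmul_eq_mul]
    gcongr
  obtain ⟨u, hu, h⟩ := hex
  have hb0 : 0 ≤ ((bad u).card : ℝ) / δ := by positivity
  obtain ⟨A', hA', h1, h2⟩ := prune (cntRep A Q u) R hR δ (by
    have : ((bad u).card : ℝ) / δ ≤ ((cntRep A Q u).card : ℝ) ^ 2 := by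
      linarith [sq_nonneg m]
    rw [div_le_iff₀ hδ] at this
    rw [mul_comm]; exact this)
  refine ⟨u, hu, A', hA'.trans (filter_subset _ _), ?_, h1, rep_count V Q _ A' τ hτ h2⟩
  exact (sq_le_sq₀ hm (by positivity)).1 (by linarith)

lemma sum_min (σ : ℝ) (hσ : 0 < σ) (T : ℕ) :
    ∑ t ∈ Icc 1 T, min 1 (σ ^ 2 / (t : ℝ) ^ 2) ≤ 3 * σ := by
  set k := ⌊σ⌋₊ with hk
  have hk1 : (k : ℝ) ≤ σ := Nat.floor_le hσ.le
  have hk2 : σ < k + 1 := Nat.lt_floor_add_one σ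
  have hsub : Icc 1 T ⊆ Icc 1 k ∪ Ioo k (T + 1) := by
    intro t; simp only [mem_union, mem_Icc, mem_Ioo]; omega
  have h1 : ∑ t ∈ Icc 1 k, min 1 (σ ^ 2 / (t : ℝ) ^ 2) ≤ σ := by
    calc _ ≤ ∑ t ∈ Icc 1 k, (1 : ℝ) := sum_le_sum fun t _ => min_le_left _ _
      _ = k := by simp
      _ ≤ σ := hk1
  have h2 : ∑ t ∈ Ioo k (T + 1), min 1 (σ ^ 2 / (t : ℝ) ^ 2) ≤ 2 * σ := by
    calc _ ≤ ∑ t ∈ Ioo k (T + 1), σ ^ 2 * ((t : ℝ) ^ 2)⁻¹ :=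
          sum_le_sum fun t _ => by rw [← div_eq_mul_inv]; exact min_le_right _ _
      _ = σ ^ 2 * ∑ t ∈ Ioo k (T + 1), ((t : ℝ) ^ 2)⁻¹ := by rw [mul_sum]
      _ ≤ σ ^ 2 * (2 / (k + 1)) := by
          gcongr
          exact sum_Ioo_inv_sq_le k (T + 1)
      _ ≤ 2 * σ := by
          rw [mul_div_assoc', div_le_iff₀ (by positivity)]
          nlinarith
  calc _ ≤ ∑ t ∈ Icc 1 k ∪ Ioo k (T + 1), min 1 (σ ^ 2 / (t : ℝ) ^ 2) :=
        sum_le_sum_of_subset_of_nonneg hsub (by intros; positivity)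
    _ ≤ _ := by
        rw [sum_union]
        · linarith
        · rw [disjoint_left]; intro t; simp only [mem_Icc, mem_Ioo]; omega

lemma layer {ι : Type*} (D : Finset ι) (r : ι → ℕ) (T : ℕ) (hT : ∀ x ∈ D, r x ≤ T) :
    ∑ x ∈ D, (r x : ℝ) ^ 2 = ∑ t ∈ Icc 1 T, ∑ x ∈ D.filter (fun x => t ≤ r x), (r x : ℝ) := by
  simp_rw [sum_filter]
  rw [sum_comm]
  refine sum_congr rfl fun x hx => ?_
  rw [← sum_filter]
  have : (Icc 1 T).filter (fun t => t ≤ r x) = Icc 1 (r x) := by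
    ext t; have := hT x hx; simp only [mem_filter, mem_Icc]; omega
  rw [this]; simp; ring

/-- selection of the threshold -/
lemma exists_thr {ι : Type*} (D : Finset ι) (r : ι → ℕ) (n s ε : ℝ) (hn : 0 < n) (hs : 1 ≤ s)
    (hε : 0 < ε) (hε2 : ε < 1 / 2)
    (hr : ∀ x ∈ D, (r x : ℝ) ≤ n / s) (hsum : ∑ x ∈ D, (r x : ℝ) ≤ n ^ 2)
    (hE : (1 - ε / 4) * (n ^ 3 / s ^ 2) ≤ ∑ x ∈ D, (r x : ℝ) ^ 2) :
    ∃ t : ℕ, 1 ≤ t ∧ (1 - ε / 2) * (n ^ 2 / s) ≤ ∑ x ∈ D.filter (fun x => t ≤ r x), (r x : ℝ) ∧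
      (ε / 16) ^ 2 * n ^ 4 / s ^ 4 ≤
        (t : ℝ) ^ 2 * ∑ x ∈ D.filter (fun x => t ≤ r x), (r x : ℝ) := by
  by_contra! hcon
  have hs0 : 0 < s := by linarith
  set T := ⌊n / s⌋₊ with hTd
  have hT1 : (T : ℝ) ≤ n / s := Nat.floor_le (by positivity)
  rw [layer D r T (fun x hx => Nat.le_floor (hr x hx))] at hE
  set σ : ℝ := ε / 16 * n / s ^ 2 with hσ
  have hσ0 : 0 < σ := by positivity
  have key : ∀ t ∈ Icc 1 T, ∑ x ∈ D.filter (fun x => t ≤ r x), (r x : ℝ) ≤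
      (1 - ε / 2) * (n ^ 2 / s) + n ^ 2 * min 1 (σ ^ 2 / (t : ℝ) ^ 2) := by
    intro t ht
    have ht1 : 1 ≤ t := (mem_Icc.1 ht).1
    have ht0 : (0 : ℝ) < t := by exact_mod_cast ht1
    have hmin : 0 ≤ n ^ 2 * min 1 (σ ^ 2 / (t : ℝ) ^ 2) := by positivity
    have hpos : 0 ≤ (1 - ε / 2) * (n ^ 2 / s) := mul_nonneg (by linarith) (by positivity)
    by_cases hc : (1 - ε / 2) * (n ^ 2 / s) ≤ ∑ x ∈ D.filter (fun x => t ≤ r x), (r x : ℝ)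
    · have h1 := hcon t ht1 hc
      have h2 : ∑ x ∈ D.filter (fun x => t ≤ r x), (r x : ℝ) ≤ n ^ 2 :=
        (sum_le_sum_of_subset_of_nonneg (filter_subset _ _) (by intros; positivity)).trans hsum
      have h3 : ∑ x ∈ D.filter (fun x => t ≤ r x), (r x : ℝ) ≤ n ^ 2 * (σ ^ 2 / (t : ℝ) ^ 2) := by
        rw [mul_div_assoc', le_div_iff₀ (by positivity)]
        have : n ^ 2 * σ ^ 2 = (ε / 16) ^ 2 * n ^ 4 / s ^ 4 := by
          rw [hσ]; field_simp
        rw [this]; linarith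
      have h4 : ∑ x ∈ D.filter (fun x => t ≤ r x), (r x : ℝ) ≤
          n ^ 2 * min 1 (σ ^ 2 / (t : ℝ) ^ 2) := by
        rw [mul_min_of_nonneg _ _ (by positivity)]
        exact le_min (by linarith) h3
      linarith
    · linarith
  have h1 := hE.trans (sum_le_sum key)
  rw [sum_add_distrib, ← mul_sum (f := fun t : ℕ => min 1 (σ ^ 2 / (t : ℝ) ^ 2))] at h1
  have h2 := mul_le_mul_of_nonneg_left (sum_min σ hσ0 T) (sq_nonneg n)
  simp only [sum_const, Nat.card_Icc, Nat.add_sub_cancel, nsmul_eq_mul] at h1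
  have h3 : (T : ℝ) * ((1 - ε / 2) * (n ^ 2 / s)) ≤ n / s * ((1 - ε / 2) * (n ^ 2 / s)) :=
    mul_le_mul_of_nonneg_right hT1 (mul_nonneg (by linarith) (by positivity))
  have h4 : n / s * ((1 - ε / 2) * (n ^ 2 / s)) = (1 - ε / 2) * (n ^ 3 / s ^ 2) := by
    field_simp
  have h5 : n ^ 2 * (3 * σ) = 3 * ε / 16 * (n ^ 3 / s ^ 2) := by
    rw [hσ]; field_simp
  have h6 : 0 < ε * (n ^ 3 / s ^ 2) := by positivity
  linarith

lemma sum_cnt_le {G : Type*} [AddCommGroup G] [DecidableEq G] (A P : Finset G) :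
    ∑ x ∈ P, ((cntRep A A x).card : ℝ) ≤ (A.card : ℝ) ^ 2 := by
  have : ∑ x ∈ P, (cntRep A A x).card ≤ A.card * A.card := by
    rw [← sum_cnt, ← smul_eq_mul]
    exact sum_le_card_nsmul _ _ _ fun u _ => card_le_card (filter_subset _ _)
  rw [sq]; exact_mod_cast this

lemma case_one {G : Type*} [AddCommGroup G] [DecidableEq G]
    (A V : Finset G) (s ε n : ℝ) (hs : 1 ≤ s) (hε : 0 < ε) (hε2 : ε < 1 / 2)
    (hA : A.Nonempty) (hn : n = A.card)
    (hV : ∀ x ∈ V, n / s ≤ ((cntRep A A x).card : ℝ))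
    (hE : ε / 4 * (n ^ 3 / s ^ 2) ≤ ∑ x ∈ V, ((cntRep A A x).card : ℝ) ^ 2) :
    ∃ A' ⊆ A, (1 - ε) * (n / s) ≤ (A'.card : ℝ) ∧
      ((A' - A').card : ℝ) ≤ 2 ^ 31 * ε⁻¹ ^ 8 * s ^ 8 * A'.card := by
  have hn0 : 0 < n := by rw [hn]; exact_mod_cast hA.card_pos
  have hs0 : 0 < s := by linarith
  obtain ⟨u, hu, A', hA', -, h2, h3⟩ := main_lemma A A V (ε ^ 2 / 64 * n / s ^ 2) (ε / 16) 0 hA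
    (by positivity) (by positivity) le_rfl (by
      refine le_trans (le_of_eq ?_) hE
      rw [← hn]; field_simp; ring)
  have hr := hV u hu
  set r : ℝ := ((cntRep A A u).card : ℝ)
  have hr0 : 0 < r := lt_of_lt_of_le (by positivity) hr
  refine ⟨A', hA', ?_, ?_⟩
  · nlinarith
  · rw [← hn] at h3
    have e1 : ((A' - A').card : ℝ) * r * (ε ^ 2 / 64 * n / s ^ 2) ^ 2
      = ((A' - A').card : ℝ) * r * ε ^ 4 * n ^ 2 / (2 ^ 12 * s ^ 4) := by
      field_simp; ring
    rw [e1, div_le_iff₀ (by positivity)] at h3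
    have h4 : ((A' - A').card : ℝ) * r * ε ^ 4 ≤ 2 ^ 13 * s ^ 4 * n ^ 2 := by
      have : 0 < n ^ 2 := by positivity
      by_contra hc; push Not at hc
      nlinarith
    have h5 : n ≤ r * s := by rwa [div_le_iff₀ hs0] at hr
    have h6 : ((A' - A').card : ℝ) * ε ^ 4 ≤ 2 ^ 13 * s ^ 6 * r := by
      have : n ^ 2 ≤ (r * s) ^ 2 := by gcongr
      have h7 : ((A' - A').card : ℝ) * r * ε ^ 4 ≤ 2 ^ 13 * s ^ 4 * (r * s) ^ 2 :=
        h4.trans (by gcongr)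
      by_contra hc; push Not at hc
      nlinarith
    have h8 : r ≤ 2 * A'.card := by nlinarith
    have h9 : ((A' - A').card : ℝ) * ε ^ 4 ≤ 2 ^ 14 * s ^ 6 * A'.card := by
      refine h6.trans ?_
      have : 2 ^ 13 * s ^ 6 * r ≤ 2 ^ 13 * s ^ 6 * (2 * A'.card) := by gcongr
      linarith
    have h10 : ((A' - A').card : ℝ) ≤ 2 ^ 14 * ε⁻¹ ^ 4 * s ^ 6 * A'.card := by
      rw [← le_div_iff₀ (by positivity)] at h9
      refine h9.trans (le_of_eq ?_)
      field_simp
    refine h10.trans ?_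
    have : 1 ≤ ε⁻¹ := (one_le_inv₀ hε).2 (by linarith)
    gcongr <;> norm_num

lemma case_two {G : Type*} [AddCommGroup G] [DecidableEq G]
    (A P : Finset G) (s ε n t N : ℝ) (hs : 1 ≤ s) (hε : 0 < ε) (hε2 : ε < 1 / 2)
    (hA : A.Nonempty) (hn : n = A.card) (ht : 0 < t)
    (hP : ∀ x ∈ P, t ≤ ((cntRep A A x).card : ℝ))
    (hN : N = ∑ x ∈ P, ((cntRep A A x).card : ℝ))
    (h1 : (1 - ε / 2) * (n ^ 2 / s) ≤ N)
    (h2 : (ε / 16) ^ 2 * n ^ 4 / s ^ 4 ≤ t ^ 2 * N) :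
    ∃ A' ⊆ A, (1 - ε) * (n / s) ≤ (A'.card : ℝ) ∧
      ((A' - A').card : ℝ) ≤ 2 ^ 31 * ε⁻¹ ^ 8 * s ^ 8 * A'.card := by
  have hn0 : 0 < n := by rw [hn]; exact_mod_cast hA.card_pos
  have hs0 : 0 < s := by linarith
  obtain ⟨p, hp⟩ : ∃ p, N = p * n ^ 2 := ⟨N / n ^ 2, by field_simp⟩
  have hp1 : (1 - ε / 2) / s ≤ p := by
    rw [hp] at h1
    have : (1 - ε / 2) / s * n ^ 2 ≤ p * n ^ 2 := by
      refine le_trans (le_of_eq ?_) h1; ring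
    exact le_of_mul_le_mul_right this (by positivity)
  have hp0 : 0 < p := lt_of_lt_of_le (div_pos (by linarith) hs0) hp1
  have hsumN : ∑ u ∈ A, ((cntRep A P u).card : ℝ) = p * n ^ 2 := by
    rw [← hp, hN]; exact_mod_cast sum_cnt A P
  have hCS : p ^ 2 * n ^ 3 ≤ ∑ u ∈ A, ((cntRep A P u).card : ℝ) ^ 2 := by
    have := sq_sum_le_card_mul_sum_sq (s := A) (f := fun u => ((cntRep A P u).card : ℝ))
    rw [hsumN, ← hn] at this
    have h : n * (p ^ 2 * n ^ 3) ≤ n * ∑ u ∈ A, ((cntRep A P u).card : ℝ) ^ 2 :=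
      le_trans (le_of_eq (by ring)) this
    exact le_of_mul_le_mul_left h hn0
  obtain ⟨u, hu, A', hA', h3, h4, h5⟩ := main_lemma A P A (ε ^ 2 / 64 * p ^ 2 * n) (ε / 16)
    ((1 - ε / 4) * p * n) hA
    (by positivity) (by positivity) (mul_nonneg (mul_nonneg (by linarith) hp0.le) hn0.le) (by
      refine le_trans ?_ hCS
      rw [← hn]
      have e : ε ^ 2 / 64 * p ^ 2 * n * n ^ 2 / (ε / 16) + n * ((1 - ε / 4) * p * n) ^ 2
        = (ε / 4 + (1 - ε / 4) ^ 2) * (p ^ 2 * n ^ 3) := by field_simp; ring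
      rw [e]
      have : ε / 4 + (1 - ε / 4) ^ 2 ≤ 1 := by nlinarith
      exact mul_le_of_le_one_left (by positivity) this)
  set r : ℝ := ((cntRep A P u).card : ℝ)
  have hpn : (1 - ε / 2) * (n / s) ≤ p * n := by
    have := mul_le_mul_of_nonneg_right hp1 hn0.le
    refine le_trans (le_of_eq ?_) this; ring
  have hns : 0 < n / s := by positivity
  have hpn0 : 0 < p * n := by positivity
  have hr0 : 0 < r := lt_of_lt_of_le (mul_pos (mul_pos (by linarith) hp0) hn0) h3
  have ha1 : (1 - ε / 4) * ((1 - ε / 4) * (p * n)) ≤ A'.card := by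
    refine le_trans ?_ h4
    have e : (1 - 4 * (ε / 16)) = 1 - ε / 4 := by ring
    rw [e]
    exact mul_le_mul_of_nonneg_left (by linarith) (by linarith)
  refine ⟨A', hA', ?_, ?_⟩
  · have : (1 - ε / 2) * (p * n) ≤ A'.card := by nlinarith
    have : (1 - ε / 2) * ((1 - ε / 2) * (n / s)) ≤ A'.card :=
      (mul_le_mul_of_nonneg_left hpn (by linarith)).trans this
    nlinarith [sq_nonneg ε]
  · have ha2 : p * n ≤ 2 * A'.card := by nlinarith
    have hPc : (P.card : ℝ) * t ≤ p * n ^ 2 := by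
      rw [← hp, hN, ← nsmul_eq_mul]
      exact card_nsmul_le_sum _ _ _ hP
    set d : ℝ := ((A' - A').card : ℝ)
    set a : ℝ := (A'.card : ℝ)
    have hd0 : 0 ≤ d := by positivity
    -- r ≥ p n / 2
    have hr2 : p * n / 2 ≤ r := by nlinarith
    have k1 : d * (p * n / 2) * (ε ^ 2 / 64 * p ^ 2 * n) ^ 2 ≤ 2 * (P.card : ℝ) ^ 4 :=
      le_trans (by gcongr) h5
    have k2 : ((P.card : ℝ) * t) ^ 4 ≤ (p * n ^ 2) ^ 4 := by gcongr
    have k3 : d * (p * n / 2) * (ε ^ 2 / 64 * p ^ 2 * n) ^ 2 * t ^ 4 ≤ 2 * (p * n ^ 2) ^ 4 := by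
      calc _ ≤ 2 * (P.card : ℝ) ^ 4 * t ^ 4 := by gcongr
        _ = 2 * ((P.card : ℝ) * t) ^ 4 := by ring
        _ ≤ _ := by gcongr
    have k4 : d * ε ^ 4 * t ^ 4 ≤ 2 ^ 14 * n ^ 5 / p := by
      rw [le_div_iff₀ hp0]
      have : (d * ε ^ 4 * t ^ 4 * p) * (p ^ 4 * n ^ 3 / 2 ^ 13) ≤
        (2 ^ 14 * n ^ 5) * (p ^ 4 * n ^ 3 / 2 ^ 13) := by
        refine le_trans (le_of_eq ?_) (k3.trans (le_of_eq ?_)) <;> ring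
      exact le_of_mul_le_mul_right this (by positivity)
    have k5 : ε ^ 4 * n ^ 4 ≤ 2 ^ 16 * s ^ 8 * t ^ 4 * p ^ 2 := by
      rw [hp, div_le_iff₀ (by positivity)] at h2
      have h6 : (ε ^ 2 * n ^ 2) * n ^ 2 ≤ (2 ^ 8 * s ^ 4 * t ^ 2 * p) * n ^ 2 := by
        linear_combination 2 ^ 8 * h2
      have h7 := le_of_mul_le_mul_right h6 (by positivity)
      have h8 : (ε ^ 2 * n ^ 2) ^ 2 ≤ (2 ^ 8 * s ^ 4 * t ^ 2 * p) ^ 2 := by gcongr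
      refine le_trans (le_of_eq ?_) (h8.trans (le_of_eq ?_)) <;> ring
    have k6 : d * ε ^ 8 ≤ 2 ^ 30 * s ^ 8 * (p * n) := by
      have h6 : (d * ε ^ 8) * (n ^ 4 * t ^ 4) ≤ (2 ^ 30 * s ^ 8 * (p * n)) * (n ^ 4 * t ^ 4) := by
        calc (d * ε ^ 8) * (n ^ 4 * t ^ 4) = (d * ε ^ 4 * t ^ 4) * (ε ^ 4 * n ^ 4) := by ring
          _ ≤ (2 ^ 14 * n ^ 5 / p) * (2 ^ 16 * s ^ 8 * t ^ 4 * p ^ 2) := by gcongr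
          _ = _ := by field_simp
      exact le_of_mul_le_mul_right h6 (by positivity)
    have k7 : d * ε ^ 8 ≤ 2 ^ 31 * s ^ 8 * a := by
      calc _ ≤ _ := k6
        _ ≤ 2 ^ 30 * s ^ 8 * (2 * a) := by gcongr
        _ = _ := by ring
    rw [← le_div_iff₀ (by positivity)] at k7
    refine k7.trans (le_of_eq ?_)
    field_simp

/-- Main theorem: if `E(A) ≥ |A|³/K` then there is `A' ⊆ A` with
`|A'| ≥ (1 - ε)·K^{-1/2}·|A|` and `|A' - A'| ≤ 2³³·ε⁻⁹·K⁴·|A'|`. -/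
theorem bsg_large_subset {G : Type*} [AddCommGroup G] [DecidableEq G]
    (A : Finset G) (K ε : ℝ) (hK : 1 ≤ K) (hε : ε ∈ Set.Ioo (0 : ℝ) (1 / 2))
    (hA : A.Nonempty) (hE : (A.card : ℝ) ^ 3 / K ≤ (addEnergyOf A : ℝ)) :
    ∃ A' ⊆ A, (1 - ε) * K ^ (-(1 : ℝ) / 2) * A.card ≤ (A'.card : ℝ) ∧
      ((A' - A').card : ℝ) ≤ 2 ^ 33 * ε ^ (-(9 : ℤ)) * K ^ 4 * A'.card := by
  obtain ⟨hε1, hε2⟩ := hε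
  have hK0 : 0 < K := by linarith
  set s := √K with hsdef
  have hs : 1 ≤ s := Real.one_le_sqrt.2 hK
  have hs0 : 0 < s := by linarith
  have hs2 : s ^ 2 = K := Real.sq_sqrt hK0.le
  have hKr : K ^ (-(1 : ℝ) / 2) = 1 / s := by
    rw [neg_div, Real.rpow_neg hK0.le, ← Real.sqrt_eq_rpow, one_div]
  set n : ℝ := (A.card : ℝ) with hn
  have hn0 : 0 < n := by rw [hn]; exact_mod_cast hA.card_pos
  suffices h : ∃ A' ⊆ A, (1 - ε) * (n / s) ≤ (A'.card : ℝ) ∧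
      ((A' - A').card : ℝ) ≤ 2 ^ 31 * ε⁻¹ ^ 8 * s ^ 8 * A'.card by
    obtain ⟨A', h0, h1, h2⟩ := h
    refine ⟨A', h0, ?_, h2.trans ?_⟩
    · rw [hKr]; refine le_trans (le_of_eq ?_) h1; ring
    · have e1 : ε ^ (-(9 : ℤ)) = ε⁻¹ ^ 9 := by
        rw [zpow_neg, inv_pow]; norm_cast
      have e2 : s ^ 8 = K ^ 4 := by rw [← hs2]; ring
      rw [e1, e2]
      have : 1 ≤ ε⁻¹ := (one_le_inv₀ hε1).2 (by linarith)
      gcongr <;> norm_num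
  have hEs : (addEnergyOf A : ℝ) = ∑ x ∈ A - A, ((cntRep A A x).card : ℝ) ^ 2 := by
    rw [energy_eq]; push_cast; rfl
  rw [hEs, ← hs2, ← sum_filter_add_sum_filter_not (A - A)
    (fun x => n / s ≤ ((cntRep A A x).card : ℝ))] at hE
  by_cases hc : ε / 4 * (n ^ 3 / s ^ 2) ≤
    ∑ x ∈ (A - A).filter (fun x => n / s ≤ ((cntRep A A x).card : ℝ)),
      ((cntRep A A x).card : ℝ) ^ 2
  · exact case_one A _ s ε n hs hε1 hε2 hA hn (fun x hx => (mem_filter.1 hx).2) hc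
  · push Not at hc
    obtain ⟨t, ht, h1, h2⟩ := exists_thr
      ((A - A).filter (fun x => ¬ n / s ≤ ((cntRep A A x).card : ℝ)))
      (fun x => (cntRep A A x).card) n s ε hn0 hs hε1 hε2
      (fun x hx => (not_le.1 (mem_filter.1 hx).2).le) (sum_cnt_le A _) (by linarith)
    exact case_two A _ s ε n t _ hs hε1 hε2 hA hn (by exact_mod_cast ht)
      (fun x hx => by exact_mod_cast (mem_filter.1 hx).2) rfl h1 h2
end

section
/- Let δ, ξ ∈ (0, 1] and let R ⊆ A × A be a binary relation on a finite set A with |R| ≥ δ·|A|². Then there is a subset A' ⊆ A of size |A'| ≥ δ(1 − ξ)|A| with the following property: for every pair (a₁, a₂) ∈ A' × A' there are at least 2^{−7}·δ⁴·ξ⁴·|A|²·|A'| triples (x, b, y) ∈ A³ such that (a₁, x) ∈ R, (b, x) ∈ R, (b, y) ∈ R, and (a₂, y) ∈ R. -/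
open Finset

set_option maxHeartbeats 1000000 in
/-- Lemma 2.1: given a relation `R ⊆ A × A` of density at least `δ`, there is a
large subset `A'` such that every pair of elements of `A'` is connected by many
paths of length four through `R`. -/
theorem dense_relation_paths {α : Type*} [DecidableEq α]
    (A : Finset α) (R : Finset (α × α)) (hR : R ⊆ A ×ˢ A)
    (δ ξ : ℝ) (hδ : δ ∈ Set.Ioc (0 : ℝ) 1) (hξ : ξ ∈ Set.Ioc (0 : ℝ) 1)
    (hRcard : δ * (A.card : ℝ) ^ 2 ≤ (R.card : ℝ)) :
    ∃ A' ⊆ A, δ * (1 - ξ) * A.card ≤ (A'.card : ℝ) ∧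
      ∀ a₁ ∈ A', ∀ a₂ ∈ A',
        2 ^ (-(7 : ℤ)) * δ ^ 4 * ξ ^ 4 * (A.card : ℝ) ^ 2 * A'.card ≤
          (((A ×ˢ A ×ˢ A).filter fun t =>
            (a₁, t.1) ∈ R ∧ (t.2.1, t.1) ∈ R ∧ (t.2.1, t.2.2) ∈ R ∧ (a₂, t.2.2) ∈ R).card : ℝ) := by
  classical
  obtain ⟨hδ0, hδ1⟩ := hδ
  obtain ⟨hξ0, hξ1⟩ := hξ
  rcases A.eq_empty_or_nonempty with hA | hA
  · subst hA
    exact ⟨∅, by simp, by simp, by simp⟩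
  set n : ℝ := (A.card : ℝ) with hn
  have hnpos : 0 < n := by rw [hn]; exact_mod_cast hA.card_pos
  set c : ℝ := δ ^ 2 * ξ ^ 2 / 8 with hc
  have hc0 : 0 ≤ c := by positivity
  let S : α → Finset α := fun x => A.filter fun a => (a, x) ∈ R
  let T : α → α → Finset α := fun a b => A.filter fun x => (a, x) ∈ R ∧ (b, x) ∈ R
  let Bad : α → α → Prop := fun a b => ((T a b).card : ℝ) < c * n
  let B : α → Finset (α × α) := fun x => (S x ×ˢ S x).filter fun p => Bad p.1 p.2
  have h1 : ∑ x ∈ A, ((S x).card : ℝ) = R.card := by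
    have : R = (A ×ˢ A).filter (fun p => (p.1, p.2) ∈ R) := by
      ext ⟨a, b⟩
      simp only [mem_filter]
      exact ⟨fun h => ⟨hR h, h⟩, fun h => h.2⟩
    rw [this]
    simp only [S, card_filter]
    push_cast
    rw [sum_product_right]
  have h2 : δ ^ 2 * n ^ 3 ≤ ∑ x ∈ A, ((S x).card : ℝ) ^ 2 := by
    have h := sq_sum_le_card_mul_sum_sq (s := A) (f := fun x => ((S x).card : ℝ))
    rw [h1, ← hn] at h
    have h' : (δ * n ^ 2) ^ 2 ≤ (R.card : ℝ) ^ 2 := by gcongr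
    have : n * (δ ^ 2 * n ^ 3) ≤ n * ∑ x ∈ A, ((S x).card : ℝ) ^ 2 := by
      calc _ = (δ * n ^ 2) ^ 2 := by ring
        _ ≤ _ := h'.trans h
    exact le_of_mul_le_mul_left this hnpos
  have h3 : ∑ x ∈ A, ((B x).card : ℝ) ≤ c * n ^ 3 := by
    have e : ∀ x ∈ A, ((B x).card : ℝ) =
        ∑ p ∈ (A ×ˢ A).filter (fun p => Bad p.1 p.2),
          if (p.1, x) ∈ R ∧ (p.2, x) ∈ R then (1 : ℝ) else 0 := by
      intro x hx
      rw [sum_boole]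
      congr 2
      ext ⟨a, b⟩
      simp only [B, S, mem_filter, mem_product]
      tauto
    rw [sum_congr rfl e, sum_comm]
    calc _ ≤ ∑ p ∈ (A ×ˢ A).filter (fun p => Bad p.1 p.2), c * n := by
          refine sum_le_sum fun p hp => ?_
          rw [sum_boole]
          exact (mem_filter.1 hp).2.le
      _ ≤ ∑ p ∈ A ×ˢ A, c * n :=
          sum_le_sum_of_subset_of_nonneg (filter_subset _ _) fun _ _ _ => by positivity
      _ = c * n ^ 3 := by
          rw [sum_const, card_product, nsmul_eq_mul]; push_cast; rw [← hn]; ring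
  obtain ⟨x, hx, hxx⟩ : ∃ x ∈ A, δ ^ 2 * (1 - ξ ^ 2) * n ^ 2 ≤
      ((S x).card : ℝ) ^ 2 - 8 * (B x).card := by
    refine exists_le_of_sum_le hA ?_
    rw [sum_sub_distrib, sum_const, nsmul_eq_mul, ← hn, ← mul_sum A (fun x => ((B x).card : ℝ)) 8]
    have : n * (δ ^ 2 * (1 - ξ ^ 2) * n ^ 2) = δ ^ 2 * n ^ 3 - 8 * (c * n ^ 3) := by
      rw [hc]; ring
    linarith
  set m : ℝ := ((S x).card : ℝ) with hm
  have hm0 : 0 ≤ m := by positivity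
  let D : α → Finset α := fun a => (S x).filter fun b => Bad a b
  let P : α → Prop := fun a => ((D a).card : ℝ) ≤ m / 4
  let A' := (S x).filter P
  let E := (S x).filter fun a => ¬ P a
  have hAE : (A'.card : ℝ) + E.card = m := by
    rw [hm]; exact_mod_cast card_filter_add_card_filter_not (s := S x) P
  have hBD : ((B x).card : ℝ) = ∑ a ∈ S x, ((D a).card : ℝ) := by
    simp only [B, D, card_filter]
    push_cast
    rw [sum_product]
  have hE : (E.card : ℝ) * (m / 4) ≤ (B x).card := by
    rw [hBD]
    calc (E.card : ℝ) * (m / 4) = ∑ a ∈ E, m / 4 := by rw [sum_const, nsmul_eq_mul]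
      _ ≤ ∑ a ∈ E, ((D a).card : ℝ) :=
          sum_le_sum fun a ha => (not_le.1 (mem_filter.1 ha).2).le
      _ ≤ _ := sum_le_sum_of_subset_of_nonneg (filter_subset _ _) fun _ _ _ => by positivity
  set p : ℝ := δ * (1 - ξ) * n with hp
  have hp0 : 0 ≤ p := by
    have : 0 ≤ 1 - ξ := by linarith
    positivity
  have hpm : p ^ 2 ≤ δ ^ 2 * (1 - ξ ^ 2) * n ^ 2 := by
    have h : (1 - ξ) ^ 2 ≤ 1 - ξ ^ 2 := by nlinarith
    calc p ^ 2 = δ ^ 2 * (1 - ξ) ^ 2 * n ^ 2 := by rw [hp]; ring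
      _ ≤ _ := by gcongr
  have hA'm : (A'.card : ℝ) ≤ m := by
    have : (0 : ℝ) ≤ E.card := by positivity
    linarith
  refine ⟨A', (filter_subset _ _).trans (filter_subset _ _), ?_, ?_⟩
  · rcases hm0.eq_or_lt with h0 | h0
    · have hB0 : (0 : ℝ) ≤ (B x).card := by positivity
      have : p ^ 2 ≤ 0 := by rw [← h0] at hxx; linarith
      have : p = 0 := by nlinarith
      rw [this]; positivity
    · have : m * p ≤ m * A'.card := by
        have e : (E.card : ℝ) = m - A'.card := by linarith
        rw [e] at hE
        nlinarith [sq_nonneg (m - p)]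
      exact le_of_mul_le_mul_left this h0
  · intro a₁ ha₁ a₂ ha₂
    let G := S x \ (D a₁ ∪ D a₂)
    have hG : m / 2 ≤ G.card := by
      have hs : (S x).card ≤ G.card + ((D a₁).card + (D a₂).card) := by
        have := le_card_sdiff (D a₁ ∪ D a₂) (S x)
        have := card_union_le (D a₁) (D a₂)
        simp only [G]
        omega
      have hs' : m ≤ G.card + ((D a₁).card + (D a₂).card) := by rw [hm]; exact_mod_cast hs
      have q1 : ((D a₁).card : ℝ) ≤ m / 4 := (mem_filter.1 ha₁).2
      have q2 : ((D a₂).card : ℝ) ≤ m / 4 := (mem_filter.1 ha₂).2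
      linarith
    have hinj : (G.sigma fun b => T a₁ b ×ˢ T a₂ b).card ≤ ((A ×ˢ A ×ˢ A).filter fun t =>
            (a₁, t.1) ∈ R ∧ (t.2.1, t.1) ∈ R ∧ (t.2.1, t.2.2) ∈ R ∧ (a₂, t.2.2) ∈ R).card := by
      refine card_le_card_of_injOn (fun q => (q.2.1, q.1, q.2.2)) ?_ ?_
      · rintro ⟨b, u, v⟩ h
        simp only [G, S, T, coe_sigma, Set.mem_sigma_iff, mem_coe, mem_sdiff, mem_filter,
          mem_product] at h ⊢
        tauto
      · rintro ⟨b, u, v⟩ _ ⟨b', u', v'⟩ _ h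
        simp only [Prod.mk.injEq] at h
        obtain ⟨rfl, rfl, rfl⟩ := h
        rfl
    have hsum : (G.card : ℝ) * (c * n) ^ 2 ≤ ((G.sigma fun b => T a₁ b ×ˢ T a₂ b).card : ℝ) := by
      rw [card_sigma, Nat.cast_sum, ← nsmul_eq_mul]
      refine card_nsmul_le_sum _ _ _ fun b hb => ?_
      rw [card_product, Nat.cast_mul]
      have hb' := mem_sdiff.1 hb
      have g1 : c * n ≤ (T a₁ b).card := by
        by_contra h
        exact hb'.2 (mem_union_left _ (mem_filter.2 ⟨hb'.1, not_le.1 h⟩))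
      have g2 : c * n ≤ (T a₂ b).card := by
        by_contra h
        exact hb'.2 (mem_union_right _ (mem_filter.2 ⟨hb'.1, not_le.1 h⟩))
      rw [sq]
      gcongr
    calc 2 ^ (-(7 : ℤ)) * δ ^ 4 * ξ ^ 4 * n ^ 2 * (A'.card : ℝ)
        ≤ 2 ^ (-(7 : ℤ)) * δ ^ 4 * ξ ^ 4 * n ^ 2 * m := by gcongr
      _ = m / 2 * (c * n) ^ 2 := by rw [hc]; norm_num; ring
      _ ≤ G.card * (c * n) ^ 2 := by gcongr
      _ ≤ _ := hsum
      _ ≤ _ := by exact_mod_cast hinj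
end

section
/- Suppose x₁, …, xₙ ∈ [0, 1] are real numbers that do not all vanish. Let S = x₁ + … + xₙ and T = x₁² + … + xₙ². Then for every α ∈ (0, 1) there exists a subset I ⊆ {1, …, n} such that ∑_{i∈I} xᵢ ≥ max{ α·T, ( (1 − α)⁵·|I|⁴·T⁴ / (2¹⁰·S²) )^{1/6} }. -/
open Finset

lemma aux_sum_sq {ι : Type*} [DecidableEq ι] (x : ι → ℝ) (hx : ∀ i, 0 ≤ x i) (K : ℝ) (hK : 0 ≤ K)
    (J : Finset ι) :
    (∀ i ∈ J, x i ^ 3 * ((J.filter (fun j => x i ≤ x j)).card : ℝ) ≤ K ^ 3) →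
    ∑ i ∈ J, x i ^ 2 ≤ 3 * K ^ 2 * (J.card : ℝ) ^ ((1 : ℝ) / 3) := by
  induction J using Finset.induction_on_min_value x with
  | empty => intro _; simp
  | insert a s ha hmin ih =>
    intro h
    have h1 := ih (by
      intro i hi
      refine le_trans ?_ (h i (Finset.mem_insert_of_mem hi))
      have : (s.filter (fun j => x i ≤ x j)).card ≤
          ((insert a s).filter (fun j => x i ≤ x j)).card :=
        Finset.card_le_card (Finset.filter_subset_filter _ (Finset.subset_insert a s))
      have h2 : ((s.filter (fun j => x i ≤ x j)).card : ℝ) ≤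
          (((insert a s).filter (fun j => x i ≤ x j)).card : ℝ) := by exact_mod_cast this
      exact mul_le_mul_of_nonneg_left h2 (pow_nonneg (hx i) 3))
    have h3 := h a (Finset.mem_insert_self a s)
    have h4 : (insert a s).filter (fun j => x a ≤ x j) = insert a s := by
      apply Finset.filter_true_of_mem
      intro j hj
      rcases Finset.mem_insert.1 hj with rfl | hj
      · exact le_rfl
      · exact hmin j hj
    rw [h4] at h3
    rw [Finset.sum_insert ha]
    rw [Finset.card_insert_of_notMem ha] at h3 ⊢
    push_cast at h3 ⊢
    have hm : (0 : ℝ) ≤ (s.card : ℝ) := Nat.cast_nonneg _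
    generalize (s.card : ℝ) = m at *
    have hb3 : (m ^ ((1 : ℝ) / 3)) ^ 3 = m := by
      rw [← Real.rpow_natCast, ← Real.rpow_mul hm]; norm_num
    have ha3 : ((m + 1) ^ ((1 : ℝ) / 3)) ^ 3 = m + 1 := by
      rw [← Real.rpow_natCast, ← Real.rpow_mul (by linarith)]; norm_num
    have hb0 : 0 ≤ m ^ ((1 : ℝ) / 3) := Real.rpow_nonneg hm _
    have ha0 : 0 < (m + 1) ^ ((1 : ℝ) / 3) := Real.rpow_pos_of_pos (by linarith) _
    generalize m ^ ((1 : ℝ) / 3) = b at *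
    generalize (m + 1) ^ ((1 : ℝ) / 3) = r at *
    have hbr : b ≤ r := by
      apply le_of_pow_le_pow_left₀ (n := 3) (by norm_num) ha0.le
      linarith
    have h5 : x a * r ≤ K := by
      apply le_of_pow_le_pow_left₀ (n := 3) (by norm_num) hK
      rw [mul_pow, ha3]; exact h3
    have h6 : x a ^ 2 * r ^ 2 ≤ K ^ 2 := by
      rw [← mul_pow]; exact pow_le_pow_left₀ (mul_nonneg (hx a) ha0.le) h5 2
    have h7 : 1 ≤ 3 * (r - b) * r ^ 2 := by
      have : r ^ 3 - b ^ 3 = 1 := by linarith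
      have h8 : (r - b) * (r ^ 2 + r * b + b ^ 2) = 1 := by rw [← this]; ring
      have h9 : r ^ 2 + r * b + b ^ 2 ≤ 3 * r ^ 2 := by nlinarith
      have := mul_le_mul_of_nonneg_left h9 (sub_nonneg.2 hbr)
      linarith
    have h10 : x a ^ 2 ≤ 3 * K ^ 2 * (r - b) := by
      have hr2 : 0 < r ^ 2 := by positivity
      refine le_of_mul_le_mul_right ?_ hr2
      have := mul_le_mul_of_nonneg_left h7 (sq_nonneg K)
      linarith
    linarith

/-- Lemma 2.2: for reals `x₁, …, xₙ ∈ [0,1]`, not all zero, with sum `S` and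
sum of squares `T`, and any `α ∈ (0,1)`, there is an index set `I` with
`∑_{i ∈ I} xᵢ ≥ max {α·T, ((1-α)⁵·|I|⁴·T⁴ / (2¹⁰·S²))^{1/6}}`. -/
theorem exists_index_set {n : ℕ} (x : Fin n → ℝ)
    (hx : ∀ i, x i ∈ Set.Icc (0 : ℝ) 1) (hne : ∃ i, x i ≠ 0)
    (S T : ℝ) (hS : S = ∑ i, x i) (hT : T = ∑ i, (x i) ^ 2)
    (α : ℝ) (hα : α ∈ Set.Ioo (0 : ℝ) 1) :
    ∃ I : Finset (Fin n),
      max (α * T) (((1 - α) ^ 5 * (I.card : ℝ) ^ 4 * T ^ 4 / (2 ^ 10 * S ^ 2)) ^ ((1 : ℝ) / 6)) ≤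
        ∑ i ∈ I, x i := by
  by_contra hcon
  push Not at hcon
  obtain ⟨hα0, hα1⟩ := hα
  have hx0 : ∀ i, 0 ≤ x i := fun i => (hx i).1
  have hx1 : ∀ i, x i ≤ 1 := fun i => (hx i).2
  have hsq : ∀ i, x i ^ 2 ≤ x i := fun i => by nlinarith [hx0 i, hx1 i]
  obtain ⟨i0, hi0⟩ := hne
  have hTpos : 0 < T := by
    rw [hT]
    exact Finset.sum_pos' (fun i _ => sq_nonneg _) ⟨i0, Finset.mem_univ _, by positivity⟩
  have hTS : T ≤ S := by rw [hT, hS]; exact Finset.sum_le_sum fun i _ => hsq i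
  have hSpos : 0 < S := by linarith
  have hβ : 0 < 1 - α := by linarith
  set C : ℝ := (1 - α) ^ 5 * T ^ 4 / (2 ^ 10 * S ^ 2) with hC
  have hCpos : 0 < C := by positivity
  set K : ℝ := C ^ ((1 : ℝ) / 6) with hKdef
  have hKpos : 0 < K := Real.rpow_pos_of_pos hCpos _
  have hK6 : K ^ 6 = C := by
    rw [hKdef, ← Real.rpow_natCast, ← Real.rpow_mul hCpos.le]; norm_num
  let U : Fin n → Finset (Fin n) := fun i => univ.filter (fun j => x i ≤ x j)
  have hgood : ∀ i, α * T ≤ ∑ j ∈ U i, x j → x i ^ 3 * ((U i).card : ℝ) ≤ K ^ 3 := by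
    intro i hi
    have h1 := hcon (U i)
    rw [lt_max_iff] at h1
    have h2 := h1.resolve_left (by linarith)
    have hA0 : 0 ≤ ∑ j ∈ U i, x j := Finset.sum_nonneg fun j _ => hx0 j
    have hNA : ((U i).card : ℝ) * x i ≤ ∑ j ∈ U i, x j := by
      rw [← nsmul_eq_mul]
      exact Finset.card_nsmul_le_sum _ _ _ (fun j hj => (Finset.mem_filter.1 hj).2)
    have hNpos : (0 : ℝ) < ((U i).card : ℝ) := by
      exact_mod_cast Finset.card_pos.2 ⟨i, by simp [U]⟩
    generalize ∑ j ∈ U i, x j = A at *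
    generalize ((U i).card : ℝ) = N at *
    have hD : (1 - α) ^ 5 * N ^ 4 * T ^ 4 / (2 ^ 10 * S ^ 2) = C * N ^ 4 := by
      rw [hC]; ring
    rw [hD] at h2
    have h3 : A ^ 6 ≤ C * N ^ 4 := by
      have h4 := pow_le_pow_left₀ hA0 h2.le 6
      have h5 : ((C * N ^ 4) ^ ((1 : ℝ) / 6)) ^ 6 = C * N ^ 4 := by
        rw [← Real.rpow_natCast, ← Real.rpow_mul (by positivity)]; norm_num
      linarith
    have h6 := pow_le_pow_left₀ (mul_nonneg hNpos.le (hx0 i)) hNA 6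
    apply le_of_pow_le_pow_left₀ (n := 2) (by norm_num) (by positivity)
    have hN4 : 0 < N ^ 4 := by positivity
    refine le_of_mul_le_mul_right ?_ hN4
    calc (x i ^ 3 * N) ^ 2 * N ^ 4 = (N * x i) ^ 6 := by ring
      _ ≤ C * N ^ 4 := by linarith
      _ = (K ^ 3) ^ 2 * N ^ 4 := by rw [← hK6]; ring
  set δ : ℝ := (1 - α) * T / (2 * S) with hδ
  have hδpos : 0 < δ := by positivity
  -- bad indices
  let B : Finset (Fin n) := univ.filter (fun i => α * T ≤ ∑ j ∈ U i, x j)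
  let Bc : Finset (Fin n) := univ.filter (fun i => ¬ α * T ≤ ∑ j ∈ U i, x j)
  have hsplit : T = ∑ i ∈ B, x i ^ 2 + ∑ i ∈ Bc, x i ^ 2 := by
    rw [hT]; exact (Finset.sum_filter_add_sum_filter_not _ _ _).symm
  have hBc : ∑ i ∈ Bc, x i ^ 2 < α * T := by
    rcases Bc.eq_empty_or_nonempty with he | hne
    · rw [he]; simp; positivity
    · obtain ⟨k, hk, hmin⟩ := Finset.exists_min_image Bc x hne
      have hk' := (Finset.mem_filter.1 hk).2
      push Not at hk'
      refine lt_of_le_of_lt ?_ hk'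
      refine le_trans (Finset.sum_le_sum fun i _ => hsq i) ?_
      exact Finset.sum_le_sum_of_subset_of_nonneg
        (fun i hi => Finset.mem_filter.2 ⟨Finset.mem_univ _, hmin i hi⟩) (fun i _ _ => hx0 i)
  let J := B.filter (fun i => δ < x i)
  let L := B.filter (fun i => ¬ δ < x i)
  have hsplit2 : ∑ i ∈ B, x i ^ 2 = ∑ i ∈ J, x i ^ 2 + ∑ i ∈ L, x i ^ 2 :=
    (Finset.sum_filter_add_sum_filter_not _ _ _).symm
  have hL : ∑ i ∈ L, x i ^ 2 ≤ δ * S := by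
    calc ∑ i ∈ L, x i ^ 2 ≤ ∑ i ∈ L, δ * x i := by
          refine Finset.sum_le_sum fun i hi => ?_
          have := (Finset.mem_filter.1 hi).2
          push Not at this
          nlinarith [hx0 i]
      _ ≤ ∑ i, δ * x i := Finset.sum_le_sum_of_subset_of_nonneg (Finset.subset_univ _)
          (fun i _ _ => mul_nonneg hδpos.le (hx0 i))
      _ = δ * S := by rw [hS, Finset.mul_sum]
  have hJB : ∀ i ∈ J, x i ^ 3 * ((U i).card : ℝ) ≤ K ^ 3 := fun i hi =>
    hgood i (Finset.mem_filter.1 (Finset.mem_filter.1 hi).1).2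
  have hJ1 : ∑ i ∈ J, x i ^ 2 ≤ 3 * K ^ 2 * (J.card : ℝ) ^ ((1 : ℝ) / 3) := by
    refine aux_sum_sq x hx0 K hKpos.le J ?_
    intro i hi
    refine le_trans ?_ (hJB i hi)
    refine mul_le_mul_of_nonneg_left ?_ (pow_nonneg (hx0 i) 3)
    exact_mod_cast Finset.card_le_card (Finset.filter_subset_filter _ (Finset.subset_univ J))
  have hJ2 : δ ^ 3 * (J.card : ℝ) ≤ K ^ 3 := by
    rcases J.eq_empty_or_nonempty with he | hne
    · rw [he]; simp; positivity
    · obtain ⟨k, hk, hmin⟩ := Finset.exists_min_image J x hne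
      refine le_trans ?_ (hJB k hk)
      have h1 : J.card ≤ (U k).card := Finset.card_le_card
        (fun i hi => Finset.mem_filter.2 ⟨Finset.mem_univ _, hmin i hi⟩)
      have h2 : (J.card : ℝ) ≤ ((U k).card : ℝ) := by exact_mod_cast h1
      have h3 : δ ^ 3 ≤ x k ^ 3 := pow_le_pow_left₀ hδpos.le (Finset.mem_filter.1 hk).2.le 3
      exact mul_le_mul h3 h2 (Nat.cast_nonneg _) (pow_nonneg (hx0 k) 3)
  have hJ3 : δ * (J.card : ℝ) ^ ((1 : ℝ) / 3) ≤ K := by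
    apply le_of_pow_le_pow_left₀ (n := 3) (by norm_num) hKpos.le
    have : ((J.card : ℝ) ^ ((1 : ℝ) / 3)) ^ 3 = J.card := by
      rw [← Real.rpow_natCast, ← Real.rpow_mul (Nat.cast_nonneg _)]; norm_num
    rw [mul_pow, this]; exact hJ2
  have hJ4 : δ * ∑ i ∈ J, x i ^ 2 ≤ 3 * K ^ 3 := by
    have h1 := mul_le_mul_of_nonneg_left hJ1 hδpos.le
    have h2 := mul_le_mul_of_nonneg_left hJ3 (show 0 ≤ 3 * K ^ 2 by positivity)
    nlinarith
  have hδS : δ * S = (1 - α) * T / 2 := by rw [hδ]; field_simp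
  have hK3 : 12 * K ^ 3 * S ≤ (1 - α) ^ 2 * T ^ 2 := by
    apply le_of_pow_le_pow_left₀ (n := 2) (by norm_num) (by positivity)
    have h1 : (12 * K ^ 3 * S) ^ 2 = 144 * K ^ 6 * S ^ 2 := by ring
    have h2 : C * S ^ 2 = (1 - α) ^ 5 * T ^ 4 / 2 ^ 10 := by rw [hC]; field_simp
    rw [h1, hK6, mul_assoc, h2]
    have h3 : (1 - α) ^ 5 ≤ (1 - α) ^ 4 :=
      pow_le_pow_of_le_one hβ.le (by linarith) (by norm_num)
    have h4 := mul_le_mul_of_nonneg_right h3 (show 0 ≤ T ^ 4 by positivity)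
    have h5 : 0 ≤ (1 - α) ^ 5 * T ^ 4 := by positivity
    have h6 : ((1 - α) ^ 2 * T ^ 2) ^ 2 = (1 - α) ^ 4 * T ^ 4 := by ring
    rw [h6]; linarith
  have hJ5 : ∑ i ∈ J, x i ^ 2 ≤ (1 - α) * T / 2 := by
    refine le_of_mul_le_mul_left (hJ4.trans ?_) hδpos
    have : δ * ((1 - α) * T / 2) = (1 - α) ^ 2 * T ^ 2 / (4 * S) := by
      rw [hδ]; field_simp; norm_num
    rw [this, le_div_iff₀ (by positivity)]
    linarith
  linarith
end

section
/- Let K ≥ 1 and ε ∈ (0, 1/2) be real numbers, let A be a nonempty finite subset of an abelian group, and let P = {d ∈ A − A : r_{A−A}(d) ≥ K^{−1/2}·|A|}. If ∑_{d∈P} r_{A−A}(d)² ≥ ε·|A|³/(4K), then there exists a subset A' ⊆ A of size |A'| ≥ (1 − ε)·K^{−1/2}·|A| such that |A' − A'| ≤ 2¹⁰·ε^{−4}·K³·|A'|. -/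
open Finset Pointwise

/-- `rDiff A d` is the number of representations of `d` as a difference of two
elements of `A`, i.e. the number of pairs `(a, b) ∈ A × A` with `a - b = d`. -/
def rDiff {G : Type*} [AddCommGroup G] [DecidableEq G] (A : Finset G) (d : G) : ℕ :=
  ((A ×ˢ A).filter fun p => p.1 - p.2 = d).card

def slc {G : Type*} [AddCommGroup G] [DecidableEq G] (A : Finset G) (d : G) : Finset G :=
  A.filter fun a => a - d ∈ A

lemma card_slc {G : Type*} [AddCommGroup G] [DecidableEq G] (A : Finset G) (d : G) :
    (slc A d).card = rDiff A d := by
  unfold slc rDiff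
  refine Finset.card_bij (fun a _ => (a, a - d)) ?_ ?_ ?_
  · intro a ha
    simp only [mem_filter, mem_product] at ha ⊢
    exact ⟨ha, by abel⟩
  · intro a _ b _ h
    exact (Prod.ext_iff.1 h).1
  · rintro ⟨a, b⟩ h
    simp only [mem_filter, mem_product] at h
    obtain ⟨⟨h1, h2⟩, h3⟩ := h
    have hb : a - d = b := by rw [← h3]; abel
    exact ⟨a, by simp only [mem_filter]; rw [hb]; exact ⟨h1, h2⟩, by rw [hb]⟩

lemma card_common {G : Type*} [AddCommGroup G] [DecidableEq G] (A P : Finset G) (a b : G) :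
    (P.filter fun d => a - d ∈ A ∧ b - d ∈ A).card ≤ rDiff A (a - b) := by
  unfold rDiff
  refine Finset.card_le_card_of_injOn (fun d => (a - d, b - d)) ?_ ?_
  · intro d hd
    simp only [coe_filter, Set.mem_setOf_eq, mem_product] at hd ⊢
    exact ⟨hd.2, by abel⟩
  · intro d _ e _ h
    have := (Prod.ext_iff.1 h).1
    simpa using this

lemma bad_sum {G : Type*} [AddCommGroup G] [DecidableEq G] (A P : Finset G) (t : ℝ)
    (ht : 0 ≤ t) :
    ∑ d ∈ P, ((((slc A d) ×ˢ (slc A d)).filter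
      fun p => (rDiff A (p.1 - p.2) : ℝ) < t).card : ℝ) ≤ t * (A.card : ℝ) ^ 2 := by
  have h1 : ∀ d, ((slc A d) ×ˢ (slc A d)).filter (fun p => (rDiff A (p.1 - p.2) : ℝ) < t)
      = ((A ×ˢ A).filter fun p => (rDiff A (p.1 - p.2) : ℝ) < t).filter
        (fun p => p.1 - d ∈ A ∧ p.2 - d ∈ A) := by
    intro d
    ext p
    simp only [slc, mem_filter, mem_product]
    tauto
  simp only [h1]
  have h2 := Finset.sum_card_bipartiteAbove_eq_sum_card_bipartiteBelow
    (s := P) (t := (A ×ˢ A).filter fun p => (rDiff A (p.1 - p.2) : ℝ) < t)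
    (fun d p => p.1 - d ∈ A ∧ p.2 - d ∈ A)
  unfold bipartiteAbove bipartiteBelow at h2
  rw [← Nat.cast_sum, h2, Nat.cast_sum]
  calc _ ≤ ∑ p ∈ (A ×ˢ A).filter fun p => (rDiff A (p.1 - p.2) : ℝ) < t, t := by
        refine Finset.sum_le_sum fun p hp => ?_
        have := (mem_filter.1 hp).2
        have h3 : ((P.filter fun d => p.1 - d ∈ A ∧ p.2 - d ∈ A).card : ℝ)
          ≤ rDiff A (p.1 - p.2) := by exact_mod_cast card_common A P p.1 p.2
        exact h3.trans this.le
    _ = (((A ×ˢ A).filter fun p => (rDiff A (p.1 - p.2) : ℝ) < t).card : ℝ) * t := by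
        rw [sum_const, nsmul_eq_mul]
    _ ≤ ((A ×ˢ A).card : ℝ) * t := by
        gcongr
        exact filter_subset _ _
    _ = _ := by rw [card_product]; push_cast; ring

lemma quad_lower {G : Type*} [AddCommGroup G] [DecidableEq G] (A B : Finset G) (a a' : G)
    (t : ℝ) (ht : 0 ≤ t)
    (hB : ∀ b ∈ B, t ≤ (rDiff A (a - b) : ℝ) ∧ t ≤ (rDiff A (a' - b) : ℝ)) :
    (B.card : ℝ) * t ^ 2 ≤ ((((A ×ˢ A) ×ˢ (A ×ˢ A)).filter
      fun q => (q.1.1 - q.1.2) - (q.2.1 - q.2.2) = a - a').card : ℝ) := by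
  have h1 : (B.sigma fun b => ((A ×ˢ A).filter fun p => p.1 - p.2 = a - b) ×ˢ
      ((A ×ˢ A).filter fun p => p.1 - p.2 = a' - b)).card ≤
      (((A ×ˢ A) ×ˢ (A ×ˢ A)).filter
      fun q => (q.1.1 - q.1.2) - (q.2.1 - q.2.2) = a - a').card := by
    refine Finset.card_le_card_of_injOn (fun x => x.2) ?_ ?_
    · rintro ⟨b, x, y⟩ h
      simp only [coe_sigma, Set.mem_sigma_iff, mem_coe, mem_product, mem_filter] at h
      simp only [mem_coe, mem_filter, mem_product]
      obtain ⟨_, ⟨h1, h2⟩, h3, h4⟩ := h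
      refine ⟨⟨h1, h3⟩, ?_⟩
      rw [h2, h4]; abel
    · rintro ⟨b, x, y⟩ h ⟨c, z, w⟩ h' e
      simp only [coe_sigma, Set.mem_sigma_iff, mem_coe, mem_product, mem_filter] at h h'
      simp only [Prod.mk.injEq] at e
      obtain ⟨rfl, rfl⟩ := e
      have : a - b = a - c := h.2.1.2.symm.trans h'.2.1.2
      have : b = c := by simpa using this
      subst this
      rfl
  rw [card_sigma] at h1
  refine le_trans ?_ (Nat.cast_le.2 h1)
  push_cast [card_product]
  rw [← nsmul_eq_mul]
  refine card_nsmul_le_sum _ _ _ fun b hb => ?_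
  obtain ⟨h2, h3⟩ := hB b hb
  unfold rDiff at h2 h3
  rw [sq]
  exact mul_le_mul h2 h3 ht (ht.trans h2)

lemma diff_bound {G : Type*} [AddCommGroup G] [DecidableEq G] (A S : Finset G) (m : ℝ)
    (h : ∀ e ∈ S, m ≤ ((((A ×ˢ A) ×ˢ (A ×ˢ A)).filter
      fun q => (q.1.1 - q.1.2) - (q.2.1 - q.2.2) = e).card : ℝ)) :
    (S.card : ℝ) * m ≤ (A.card : ℝ) ^ 4 := by
  have h1 := card_nsmul_le_sum S _ m h
  rw [nsmul_eq_mul] at h1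
  refine h1.trans ?_
  have h2 : ∑ e ∈ S, (((A ×ˢ A) ×ˢ (A ×ˢ A)).filter
      fun q => (q.1.1 - q.1.2) - (q.2.1 - q.2.2) = e).card ≤ ((A ×ˢ A) ×ˢ (A ×ˢ A)).card := by
    rw [← card_biUnion]
    · exact card_le_card (biUnion_subset.2 fun e _ => filter_subset _ _)
    · intro e _ f _ hef
      refine disjoint_filter.2 fun q _ h1 h2 => hef (h1.symm.trans h2)
  have h3 : ((A ×ˢ A) ×ˢ (A ×ˢ A)).card = A.card ^ 4 := by
    simp only [card_product]; ring
  rw [h3] at h2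
  exact_mod_cast h2

/-- Lemma 3.1 (the popular-differences case): if the differences with at least
`K^{-1/2}·|A|` representations carry energy at least `ε·|A|³/(4K)`, then there is
`A' ⊆ A` with `|A'| ≥ (1-ε)·K^{-1/2}·|A|` and `|A' - A'| ≤ 2¹⁰·ε⁻⁴·K³·|A'|`. -/
theorem bsg_popular_case {G : Type*} [AddCommGroup G] [DecidableEq G]
    (A : Finset G) (K ε : ℝ) (hK : 1 ≤ K) (hε : ε ∈ Set.Ioo (0 : ℝ) (1 / 2))
    (hA : A.Nonempty)
    (hP : ε * (A.card : ℝ) ^ 3 / (4 * K) ≤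
      ∑ d ∈ (A - A).filter fun d => K ^ (-(1 : ℝ) / 2) * A.card ≤ (rDiff A d : ℝ),
        (rDiff A d : ℝ) ^ 2) :
    ∃ A' ⊆ A, (1 - ε) * K ^ (-(1 : ℝ) / 2) * A.card ≤ (A'.card : ℝ) ∧
      ((A' - A').card : ℝ) ≤ 2 ^ 10 * ε ^ (-(4 : ℤ)) * K ^ 3 * A'.card := by
  obtain ⟨hε0, hε1⟩ := hε
  have hn : (0 : ℝ) < A.card := by exact_mod_cast hA.card_pos
  have hK0 : 0 < K := by linarith
  set n : ℝ := (A.card : ℝ) with hn_def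
  set κ : ℝ := K ^ (-(1 : ℝ) / 2) with hκ
  have hκ0 : 0 < κ := Real.rpow_pos_of_pos hK0 _
  have hκ2 : K * κ ^ 2 = 1 := by
    rw [hκ, ← Real.rpow_natCast, ← Real.rpow_mul hK0.le]
    norm_num [Real.rpow_neg_one]
    field_simp
  set P := (A - A).filter fun d => κ * n ≤ (rDiff A d : ℝ) with hPdef
  set t : ℝ := ε ^ 2 / (16 * K) * n with ht_def
  have ht : 0 < t := by positivity
  have hsum := bad_sum A P t ht.le
  have hPne : P.Nonempty := by
    by_contra h
    rw [not_nonempty_iff_eq_empty] at h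
    rw [h, sum_empty] at hP
    have : 0 < ε * n ^ 3 / (4 * K) := by positivity
    linarith
  obtain ⟨d, hdP, hd⟩ : ∃ d ∈ P, ((((slc A d) ×ˢ (slc A d)).filter
      fun p => (rDiff A (p.1 - p.2) : ℝ) < t).card : ℝ) ≤ ε / 4 * (rDiff A d : ℝ) ^ 2 := by
    refine exists_le_of_sum_le hPne (hsum.trans ?_)
    rw [← mul_sum]
    calc t * n ^ 2 = ε / 4 * (ε * n ^ 3 / (4 * K)) := by rw [ht_def]; field_simp; ring
      _ ≤ _ := by gcongr
  have hdn : κ * n ≤ (rDiff A d : ℝ) := (mem_filter.1 hdP).2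
  rw [← card_slc] at hd hdn
  set D := slc A d with hD
  set m : ℝ := (D.card : ℝ) with hm_def
  have hm : 0 < m := lt_of_lt_of_le (by positivity) hdn
  let bad : G → Finset G := fun a => D.filter fun b => (rDiff A (a - b) : ℝ) < t
  set A' := D.filter fun a => ((bad a).card : ℝ) ≤ m / 4 with hA'
  have hbad : ((D ×ˢ D).filter fun p => (rDiff A (p.1 - p.2) : ℝ) < t).card
      = ∑ a ∈ D, (bad a).card := by
    simp only [bad, card_filter, sum_product]
  have hR : ((D.filter fun a => ¬ ((bad a).card : ℝ) ≤ m / 4).card : ℝ) * (m / 4)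
      ≤ ε / 4 * m ^ 2 := by
    refine le_trans ?_ hd
    rw [hbad, ← nsmul_eq_mul, Nat.cast_sum]
    refine (card_nsmul_le_sum _ (fun a => ((bad a).card : ℝ)) _ fun a ha => ?_).trans
      (sum_le_sum_of_subset_of_nonneg (filter_subset _ D) fun _ _ _ => Nat.cast_nonneg _)
    exact (not_le.1 (mem_filter.1 ha).2).le
  have hsplit : (A'.card : ℝ) + ((D.filter fun a => ¬ ((bad a).card : ℝ) ≤ m / 4).card : ℝ) = m := by
    rw [hm_def, hA']
    exact_mod_cast card_filter_add_card_filter_not (s := D) (fun a => ((bad a).card : ℝ) ≤ m / 4)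
  have hA'm : (1 - ε) * m ≤ A'.card := by
    have : ((D.filter fun a => ¬ ((bad a).card : ℝ) ≤ m / 4).card : ℝ) ≤ ε * m := by
      refine le_of_mul_le_mul_right ?_ (by positivity : 0 < m / 4)
      linarith
    linarith
  have key := diff_bound A (A' - A') (m / 2 * t ^ 2) (by
    intro e he
    obtain ⟨a, ha, a', ha', rfl⟩ := mem_sub.1 he
    have h1 := quad_lower A (D \ (bad a ∪ bad a')) a a' t ht.le (by
      intro b hb
      simp only [bad, mem_sdiff, mem_union, mem_filter, not_or, not_and, not_lt] at hb
      exact ⟨hb.2.1 hb.1, hb.2.2 hb.1⟩)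
    refine le_trans ?_ h1
    have h2 : (D.card : ℝ) ≤ (D \ (bad a ∪ bad a')).card + (bad a ∪ bad a').card := by
      have := le_card_sdiff (bad a ∪ bad a') D
      have : D.card ≤ (D \ (bad a ∪ bad a')).card + (bad a ∪ bad a').card := by omega
      exact_mod_cast this
    have h3 : ((bad a ∪ bad a').card : ℝ) ≤ (bad a).card + (bad a').card := by
      exact_mod_cast card_union_le _ _
    have h4 := (mem_filter.1 ha).2
    have h5 := (mem_filter.1 ha').2
    gcongr
    linarith)
  refine ⟨A', (filter_subset _ _).trans (filter_subset _ _), ?_, ?_⟩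
  · calc (1 - ε) * κ * n = (1 - ε) * (κ * n) := by ring
      _ ≤ (1 - ε) * m := mul_le_mul_of_nonneg_left hdn (by linarith)
      _ ≤ _ := hA'm
  · have h2 : m ≤ 2 * A'.card := by nlinarith
    have h3 : n ^ 2 ≤ K * m ^ 2 := by
      calc n ^ 2 = K * (κ * n) ^ 2 := by rw [mul_pow, ← mul_assoc, hκ2, one_mul]
        _ ≤ _ := by gcongr
    refine le_of_mul_le_mul_right (key.trans ?_) (by positivity : 0 < m / 2 * t ^ 2)
    have h4 : 2 ^ 10 * ε ^ (-(4 : ℤ)) * K ^ 3 * (A'.card : ℝ) * (m / 2 * t ^ 2)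
        = (K * m * (2 * A'.card)) * n ^ 2 := by
      have h5 : ε ^ (-(4 : ℤ)) = (ε ^ 4)⁻¹ := by rw [zpow_neg]; norm_cast
      rw [ht_def, h5]
      field_simp
      ring
    rw [h4]
    calc n ^ 4 = n ^ 2 * n ^ 2 := by ring
      _ ≤ (K * m ^ 2) * n ^ 2 := by gcongr
      _ = (K * m * m) * n ^ 2 := by ring
      _ ≤ _ := by gcongr
end

section
/- Let K ≥ 1 and ε ∈ (0, 1/2) be real numbers, let A be a nonempty finite subset of an abelian group, and let Q = {d ∈ A − A : r_{A−A}(d) < K^{−1/2}·|A|}. If ∑_{d∈Q} r_{A−A}(d)² ≥ (1 − ε/4)·|A|³/K, then there exists a subset A' ⊆ A of size |A'| ≥ (1 − ε)·K^{−1/2}·|A| such that |A' − A'| ≤ 2³³·ε^{−9}·K⁴·|A'|. -/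
open Finset Pointwise

def cdg {G : Type*} [AddCommGroup G] [DecidableEq G] (A D : Finset G) (a b : G) : ℕ :=
  (A.filter fun y => a - y ∈ D ∧ b - y ∈ D).card

lemma cdg_comm {G : Type*} [AddCommGroup G] [DecidableEq G] (A D : Finset G) (a b : G) :
    cdg A D a b = cdg A D b a := by
  unfold cdg; congr 1; ext; simp [and_comm]

lemma exists_nbhd {G : Type*} [AddCommGroup G] [DecidableEq G] (A D : Finset G)
    (hA : A.Nonempty) (δ γ η : ℝ) (hη : 0 < η) (hγ : 0 < γ)
    (hδ : δ * (A.card : ℝ) ^ 2 = ∑ x ∈ A, ((A.filter fun a => a - x ∈ D).card : ℝ)) :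
    ∃ N ⊆ A, (1 - γ / η) * δ ^ 2 * (A.card : ℝ) ^ 2 +
      (((N ×ˢ N).filter fun p => (cdg A D p.1 p.2 : ℝ) < γ * δ ^ 2 * A.card).card : ℝ) / η
        ≤ (N.card : ℝ) ^ 2 := by
  classical
  have hn : (0 : ℝ) < A.card := by exact_mod_cast hA.card_pos
  set n : ℝ := (A.card : ℝ) with hnd
  let N : G → Finset G := fun x => A.filter fun a => a - x ∈ D
  let bad : G × G → Prop := fun p => (cdg A D p.1 p.2 : ℝ) < γ * δ ^ 2 * n
  have hcs : δ ^ 2 * n ^ 3 ≤ ∑ x ∈ A, ((N x).card : ℝ) ^ 2 := by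
    have h := sq_sum_le_card_mul_sum_sq (s := A) (f := fun x => ((N x).card : ℝ))
    rw [← hδ] at h
    have : n * (δ ^ 2 * n ^ 3) ≤ n * ∑ x ∈ A, ((N x).card : ℝ) ^ 2 := by
      calc _ = (δ * n ^ 2) ^ 2 := by ring
        _ ≤ _ := h
    exact le_of_mul_le_mul_left this hn
  have hbad : ∑ x ∈ A, ((((N x) ×ˢ (N x)).filter bad).card : ℝ) ≤ γ * δ ^ 2 * n ^ 3 := by
    have h1 : ∀ x ∈ A, ((((N x) ×ˢ (N x)).filter bad).card : ℝ)
        = ∑ p ∈ (A ×ˢ A).filter bad, if (p.1 - x ∈ D ∧ p.2 - x ∈ D) then (1:ℝ) else 0 := by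
      intro x _
      rw [Finset.sum_boole]
      congr 2
      ext p
      simp only [N, mem_filter, mem_product]
      tauto
    rw [Finset.sum_congr rfl h1, Finset.sum_comm]
    have h2 : ∀ p ∈ (A ×ˢ A).filter bad,
        (∑ x ∈ A, if (p.1 - x ∈ D ∧ p.2 - x ∈ D) then (1:ℝ) else 0) ≤ γ * δ ^ 2 * n := by
      intro p hp
      rw [Finset.sum_boole]
      exact le_of_lt (mem_filter.1 hp).2
    refine (Finset.sum_le_card_nsmul _ _ _ h2).trans ?_
    rw [nsmul_eq_mul]
    have h3 : (((A ×ˢ A).filter bad).card : ℝ) ≤ n ^ 2 := by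
      have := Finset.card_filter_le (A ×ˢ A) bad
      rw [card_product] at this
      have h4 : (((A ×ˢ A).filter bad).card : ℝ) ≤ (A.card : ℝ) * A.card := by exact_mod_cast this
      exact h4.trans (le_of_eq (by rw [sq]))
    calc _ ≤ n ^ 2 * (γ * δ ^ 2 * n) := by gcongr
      _ = _ := by ring
  have hsum : ∑ x ∈ A, ((1 - γ / η) * δ ^ 2 * n ^ 2 +
      ((((N x) ×ˢ (N x)).filter bad).card : ℝ) / η) ≤ ∑ x ∈ A, ((N x).card : ℝ) ^ 2 := by
    rw [Finset.sum_add_distrib, Finset.sum_const, nsmul_eq_mul, ← Finset.sum_div]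
    refine le_trans ?_ hcs
    have : (∑ x ∈ A, ((((N x) ×ˢ (N x)).filter bad).card : ℝ)) / η ≤ γ * δ ^ 2 * n ^ 3 / η := by
      gcongr
    have e : n * ((1 - γ / η) * δ ^ 2 * n ^ 2) + γ * δ ^ 2 * n ^ 3 / η = δ ^ 2 * n ^ 3 := by
      field_simp; ring
    linarith
  obtain ⟨x, hx, h⟩ := Finset.exists_le_of_sum_le hA hsum
  exact ⟨N x, filter_subset _ _, h⟩

lemma graph_lemma {G : Type*} [AddCommGroup G] [DecidableEq G] (A D : Finset G)
    (hA : A.Nonempty) (δ ε : ℝ) (hε : 0 < ε) (hε2 : ε < 1 / 2) (hδ0 : 0 < δ)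
    (hδ : δ * (A.card : ℝ) ^ 2 = ∑ x ∈ A, ((A.filter fun a => a - x ∈ D).card : ℝ)) :
    ∃ A' ⊆ A, (1 - ε / 2) * δ * A.card ≤ (A'.card : ℝ) ∧ ∀ a ∈ A', ∀ b ∈ A',
      ε ^ 4 / 2 ^ 14 * δ ^ 5 * (A.card : ℝ) ^ 3 ≤
        ∑ u ∈ A, (cdg A D a u : ℝ) * (cdg A D b u : ℝ) := by
  classical
  have hn : (0 : ℝ) < A.card := by exact_mod_cast hA.card_pos
  obtain ⟨N, hNA, hN⟩ := exists_nbhd A D hA δ (ε ^ 2 / 64) (ε / 16) (by positivity)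
    (by positivity) hδ
  set n : ℝ := (A.card : ℝ) with hnd
  set t : ℝ := ε ^ 2 / 64 * δ ^ 2 * n with ht
  have htp : 0 < t := by positivity
  have e1 : ε ^ 2 / 64 / (ε / 16) = ε / 4 := by field_simp; norm_num
  rw [e1] at hN
  set m : ℝ := (N.card : ℝ) with hm
  set B : ℝ := (((N ×ˢ N).filter fun p => (cdg A D p.1 p.2 : ℝ) < t).card : ℝ) with hB
  have hB0 : 0 ≤ B := by positivity
  have hm0 : 0 ≤ m := by positivity
  have hmlow : (1 - ε / 4) * δ * n ≤ m := by
    refine abs_le_of_sq_le_sq' ?_ hm0 |>.2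
    have : 0 ≤ B / (ε / 16) := by positivity
    have h2 : (1 - ε / 4) ^ 2 * (δ ^ 2 * n ^ 2) ≤ (1 - ε / 4) * (δ ^ 2 * n ^ 2) := by
      gcongr; nlinarith
    nlinarith
  have hmpos : 0 < m := lt_of_lt_of_le (by
    have : 0 < 1 - ε / 4 := by linarith
    positivity) hmlow
  have hBm : B ≤ ε / 16 * m ^ 2 := by
    have h2 : 0 ≤ (1 - ε / 4) * δ ^ 2 * n ^ 2 := by
      have : 0 < 1 - ε / 4 := by linarith
      positivity
    have : B / (ε / 16) ≤ m ^ 2 := by linarith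
    rw [div_le_iff₀ (by positivity)] at this
    linarith
  let bd : G → Finset G := fun a => N.filter fun u => (cdg A D a u : ℝ) < t
  have hBsum : B = ∑ a ∈ N, ((bd a).card : ℝ) := by
    rw [hB, Finset.card_filter, Finset.sum_product]
    push_cast
    refine Finset.sum_congr rfl fun a _ => ?_
    simp only [bd, Finset.card_filter]
    push_cast; rfl
  let X := N.filter fun a => m / 4 < ((bd a).card : ℝ)
  let A' := N.filter fun a => ¬ m / 4 < ((bd a).card : ℝ)
  have hX : (X.card : ℝ) * (m / 4) ≤ B := by
    rw [hBsum]
    calc (X.card : ℝ) * (m / 4) = ∑ a ∈ X, m / 4 := by simp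
      _ ≤ ∑ a ∈ X, ((bd a).card : ℝ) := Finset.sum_le_sum fun a ha => (mem_filter.1 ha).2.le
      _ ≤ _ := Finset.sum_le_sum_of_subset_of_nonneg (filter_subset _ _) (by intros; positivity)
  have hXA : (X.card : ℝ) + A'.card = m := by
    rw [hm]; exact_mod_cast Finset.card_filter_add_card_filter_not (s := N) _
  have hXle : (X.card : ℝ) ≤ ε / 4 * m := by
    have : (X.card : ℝ) * (m / 4) ≤ (ε / 4 * m) * (m / 4) := by nlinarith
    exact le_of_mul_le_mul_right this (by positivity)
  refine ⟨A', (filter_subset _ _).trans hNA, ?_, ?_⟩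
  · have h1 : (1 - ε / 4) * m ≤ A'.card := by linarith
    refine le_trans ?_ h1
    have h2 : (1 - ε / 4) * ((1 - ε / 4) * δ * n) ≤ (1 - ε / 4) * m :=
      mul_le_mul_of_nonneg_left hmlow (by linarith)
    have h3 : 0 < δ * n := by positivity
    nlinarith [mul_pos h3 (mul_pos hε hε)]
  · intro a ha b hb
    have ha' := not_lt.1 (mem_filter.1 ha).2
    have hb' := not_lt.1 (mem_filter.1 hb).2
    let Y := N \ (bd a ∪ bd b)
    have hY : m / 2 ≤ (Y.card : ℝ) := by
      have h1 : N.card ≤ Y.card + (bd a ∪ bd b).card := by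
        have : N.card - (bd a ∪ bd b).card ≤ Y.card := Finset.le_card_sdiff (bd a ∪ bd b) N
        omega
      have h2 := Finset.card_union_le (bd a) (bd b)
      have h3 : (N.card : ℝ) ≤ Y.card + ((bd a).card + (bd b).card) := by
        exact_mod_cast h1.trans (by omega)
      linarith
    calc ε ^ 4 / 2 ^ 14 * δ ^ 5 * n ^ 3 = (δ * n / 4) * (t * t) := by rw [ht]; ring
      _ ≤ (Y.card : ℝ) * (t * t) := by
        have : δ * n / 4 ≤ Y.card := by
          have : 0 < δ * n := by positivity
          nlinarith
        gcongr
      _ = ∑ u ∈ Y, t * t := by simp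
      _ ≤ ∑ u ∈ Y, (cdg A D a u : ℝ) * (cdg A D b u : ℝ) := by
        refine Finset.sum_le_sum fun u hu => ?_
        simp only [Y, bd, mem_sdiff, mem_union, mem_filter, not_or, not_and, not_lt] at hu
        exact mul_le_mul (hu.2.1 hu.1) (hu.2.2 hu.1) htp.le (by positivity)
      _ ≤ _ := Finset.sum_le_sum_of_subset_of_nonneg (sdiff_subset.trans hNA)
        (by intros; positivity)

lemma path_count {G : Type*} [AddCommGroup G] [DecidableEq G] (A D A' : Finset G) (P : ℝ)
    (h : ∀ a ∈ A', ∀ b ∈ A', P ≤ ∑ u ∈ A, (cdg A D a u : ℝ) * (cdg A D b u : ℝ)) :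
    ((A' - A').card : ℝ) * P ≤ (D.card : ℝ) ^ 4 := by
  classical
  let T : Finset (G × G × G × G) := D ×ˢ D ×ˢ D ×ˢ D
  let f : G × G × G × G → G := fun q => q.1 - q.2.1 - (q.2.2.1 - q.2.2.2)
  have h1 : ∀ s ∈ A' - A', P ≤ ((T.filter fun q => f q = s).card : ℝ) := by
    intro s hs
    obtain ⟨a, ha, b, hb, rfl⟩ := Finset.mem_sub.1 hs
    refine (h a ha b hb).trans ?_
    let C : G → G → Finset G := fun a u => A.filter fun y => a - y ∈ D ∧ u - y ∈ D
    let S : Finset (Σ _ : G, G × G) := A.sigma fun u => C a u ×ˢ C b u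
    have hS : (∑ u ∈ A, (cdg A D a u : ℝ) * (cdg A D b u : ℝ)) = S.card := by
      simp only [S, Finset.card_sigma, card_product]
      push_cast; rfl
    rw [hS]
    norm_cast
    refine Finset.card_le_card_of_injOn
      (fun p => (a - p.2.1, p.1 - p.2.1, b - p.2.2, p.1 - p.2.2)) ?_ ?_
    · rintro ⟨u, y, z⟩ hp
      simp only [S, C, mem_coe, mem_sigma, mem_product, mem_filter] at hp
      simp only [T, f, mem_coe, mem_product, mem_filter]
      refine ⟨⟨hp.2.1.2.1, hp.2.1.2.2, hp.2.2.2.1, hp.2.2.2.2⟩, by abel⟩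
    · rintro ⟨u, y, z⟩ _ ⟨u', y', z'⟩ _ hpq
      simp only [Prod.mk.injEq, sub_right_inj] at hpq
      obtain ⟨rfl, h2, rfl, h4⟩ := hpq
      rw [sub_left_inj] at h2
      subst h2; rfl
  have h2 : ∑ s ∈ A' - A', ((T.filter fun q => f q = s).card : ℝ) ≤ T.card := by
    have h5 := Finset.sum_card_fiberwise_eq_card_filter T (A' - A') f
    have h6 := h5.trans_le (Finset.card_filter_le _ _)
    exact_mod_cast h6
  have h3 := Finset.card_nsmul_le_sum _ _ _ h1
  rw [nsmul_eq_mul] at h3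
  refine h3.trans (h2.trans (le_of_eq ?_))
  simp only [T, card_product]; push_cast; ring

lemma sum_min_bound (M : ℕ) (T : ℝ) (hT : 0 < T) :
    ∑ k ∈ Finset.range M, 4 * T ^ 2 / (T + (k + 1 : ℕ)) ^ 2 ≤ 4 * T := by
  have h : ∑ k ∈ Finset.range M, 4 * T ^ 2 / (T + (k + 1 : ℕ)) ^ 2 ≤ 4 * T - 4 * T ^ 2 / (T + M) := by
    induction M with
    | zero => simp; field_simp; simp
    | succ k ih =>
      rw [Finset.sum_range_succ]
      have hk : (0:ℝ) ≤ k := by positivity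
      have : 4 * T ^ 2 / (T + (k + 1 : ℕ)) ^ 2 ≤ 4 * T ^ 2 / (T + k) - 4 * T ^ 2 / (T + (k + 1 : ℕ)) := by
        push_cast
        rw [div_sub_div _ _ (by positivity) (by positivity), div_le_div_iff₀ (by positivity) (by positivity)]
        have : 0 < T ^ 2 * (T + (k + 1)) := by positivity
        nlinarith
      linarith
  have : 0 ≤ 4 * T ^ 2 / (T + M) := by positivity
  linarith

lemma rDiff_sum {G : Type*} [AddCommGroup G] [DecidableEq G] (A D : Finset G) :
    (∑ x ∈ A, ((A.filter fun a => a - x ∈ D).card : ℝ)) = ∑ d ∈ D, (rDiff A d : ℝ) := by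
  norm_cast
  have h1 : ∑ d ∈ D, rDiff A d = ((A ×ˢ A).filter fun p => p.1 - p.2 ∈ D).card := by
    rw [Finset.card_eq_sum_card_fiberwise (f := fun p : G × G => p.1 - p.2) (t := D)]
    · refine Finset.sum_congr rfl fun d hd => ?_
      unfold rDiff
      congr 1; ext p
      simp only [mem_filter]
      constructor
      · rintro ⟨h, rfl⟩; exact ⟨⟨h, hd⟩, rfl⟩
      · rintro ⟨⟨h, _⟩, h'⟩; exact ⟨h, h'⟩
    · intro p hp; exact (mem_filter.1 hp).2
  rw [h1, Finset.card_filter, Finset.sum_product_right]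
  simp only [Finset.card_filter]

lemma exists_level {G : Type*} [AddCommGroup G] [DecidableEq G]
    (A Q : Finset G) (K ε κ : ℝ) (hκ : 0 < κ) (hκ2 : κ ^ 2 * K = 1) (hK : 1 ≤ K)
    (hε : 0 < ε) (hε2 : ε < 1 / 2) (hA : A.Nonempty)
    (hQlt : ∀ d ∈ Q, (rDiff A d : ℝ) < κ * A.card)
    (hQ : (1 - ε / 4) * (A.card : ℝ) ^ 3 / K ≤ ∑ d ∈ Q, (rDiff A d : ℝ) ^ 2) :
    ∃ (k : ℕ) (D : Finset G), 1 ≤ k ∧ (∀ d ∈ D, k ≤ rDiff A d) ∧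
      (1 - ε / 2) * κ * (A.card : ℝ) ^ 2 ≤ ∑ d ∈ D, (rDiff A d : ℝ) ∧
      ε ^ 2 / 256 * (A.card : ℝ) ^ 4 / K ^ 2 ≤ (∑ d ∈ D, (rDiff A d : ℝ)) * (k : ℝ) ^ 2 := by
  classical
  by_contra hcon
  push Not at hcon
  have hn : (0 : ℝ) < A.card := by exact_mod_cast hA.card_pos
  set n : ℝ := (A.card : ℝ) with hnd
  have hK0 : 0 < K := by linarith
  let R : ℕ → ℝ := fun k => ∑ d ∈ Q.filter (fun d => k ≤ rDiff A d), (rDiff A d : ℝ)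
  have hRn : ∀ k, R k ≤ n ^ 2 := by
    intro k
    simp only [R]
    rw [← rDiff_sum]
    calc _ ≤ ∑ x ∈ A, n := Finset.sum_le_sum fun x _ => by
          rw [hnd]; exact_mod_cast Finset.card_filter_le _ _
      _ = n ^ 2 := by simp [hnd, sq]
  set M : ℕ := ⌈κ * n⌉₊ - 1 with hM
  have hMlt : (M : ℝ) < κ * n := by
    have h1 : 0 < ⌈κ * n⌉₊ := Nat.ceil_pos.2 (by positivity)
    exact Nat.lt_ceil.1 (by omega)
  have hrM : ∀ d ∈ Q, rDiff A d ≤ M := by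
    intro d hd
    have := Nat.lt_ceil.2 (hQlt d hd)
    omega
  have hE : ∑ d ∈ Q, (rDiff A d : ℝ) ^ 2 = ∑ k ∈ Finset.range M, R (k + 1) := by
    simp only [R, Finset.sum_filter]
    rw [Finset.sum_comm]
    refine Finset.sum_congr rfl fun d hd => ?_
    rw [← Finset.sum_filter]
    have : (Finset.range M).filter (fun k => k + 1 ≤ rDiff A d) = Finset.range (rDiff A d) := by
      ext k
      have := hrM d hd
      simp only [mem_filter, mem_range]; omega
    rw [this]; simp [sq]
  set T : ℝ := ε / 16 * n / K with hT
  have hTp : 0 < T := by positivity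
  have hb : ∀ k ∈ Finset.range M, R (k + 1) ≤
      (1 - ε / 2) * κ * n ^ 2 + n ^ 2 * (4 * T ^ 2 / (T + (k + 1 : ℕ)) ^ 2) := by
    intro k _
    have hp : 0 ≤ (1 - ε / 2) * κ * n ^ 2 := by
      have : 0 < 1 - ε / 2 := by linarith
      positivity
    have hp2 : 0 ≤ n ^ 2 * (4 * T ^ 2 / (T + (k + 1 : ℕ)) ^ 2) := by positivity
    by_cases h1 : (1 - ε / 2) * κ * n ^ 2 ≤ R (k + 1)
    · have h2 := hcon (k + 1) (Q.filter (fun d => k + 1 ≤ rDiff A d)) (by omega)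
        (fun d hd => (mem_filter.1 hd).2) h1
      change R (k + 1) * ((k + 1 : ℕ) : ℝ) ^ 2 < _ at h2
      have h3 := hRn (k + 1)
      have hj : (0 : ℝ) < ((k + 1 : ℕ) : ℝ) := by positivity
      generalize ((k + 1 : ℕ) : ℝ) = j at *
      generalize R (k + 1) = r at *
      have e : ε ^ 2 / 256 * n ^ 4 / K ^ 2 = n ^ 2 * T ^ 2 := by rw [hT]; field_simp; norm_num
      rw [e] at h2
      have hr : 0 ≤ r := hp.trans h1
      have : r ≤ n ^ 2 * (4 * T ^ 2 / (T + j) ^ 2) := by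
        rw [← mul_div_assoc, le_div_iff₀ (by positivity)]
        have h4 : r * T ^ 2 ≤ n ^ 2 * T ^ 2 := by gcongr
        have h5 : r * (T + j) ^ 2 ≤ r * (2 * T ^ 2 + 2 * j ^ 2) := by
          gcongr; nlinarith [sq_nonneg (T - j)]
        nlinarith
      linarith
    · linarith
  have hs := Finset.sum_le_sum hb
  rw [← hE, Finset.sum_add_distrib, Finset.sum_const, card_range, nsmul_eq_mul,
    ← Finset.mul_sum] at hs
  have h6 := mul_le_mul_of_nonneg_left (sum_min_bound M T hTp) (sq_nonneg n)
  have h7 : (M : ℝ) * ((1 - ε / 2) * κ * n ^ 2) < κ * n * ((1 - ε / 2) * κ * n ^ 2) := by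
    have : 0 < 1 - ε / 2 := by linarith
    gcongr
  have hκK : κ ^ 2 = 1 / K := by field_simp; linarith
  have h8 : κ * n * ((1 - ε / 2) * κ * n ^ 2) = (1 - ε / 2) * n ^ 3 / K := by
    calc _ = (1 - ε / 2) * n ^ 3 * κ ^ 2 := by ring
      _ = _ := by rw [hκK]; ring
  have h9 : n ^ 2 * (4 * T) = ε / 4 * n ^ 3 / K := by rw [hT]; ring
  have h10 : (1 - ε / 4) * n ^ 3 / K = (1 - ε / 2) * n ^ 3 / K + ε / 4 * n ^ 3 / K := by ring
  linarith

/-- Lemma 3.2 (the unpopular-differences case): if the differences with fewer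
than `K^{-1/2}·|A|` representations carry energy at least `(1-ε/4)·|A|³/K`, then
there is `A' ⊆ A` with `|A'| ≥ (1-ε)·K^{-1/2}·|A|` and
`|A' - A'| ≤ 2³³·ε⁻⁹·K⁴·|A'|`. -/
theorem bsg_unpopular_case {G : Type*} [AddCommGroup G] [DecidableEq G]
    (A : Finset G) (K ε : ℝ) (hK : 1 ≤ K) (hε : ε ∈ Set.Ioo (0 : ℝ) (1 / 2))
    (hA : A.Nonempty)
    (hQ : (1 - ε / 4) * (A.card : ℝ) ^ 3 / K ≤
      ∑ d ∈ (A - A).filter fun d => (rDiff A d : ℝ) < K ^ (-(1 : ℝ) / 2) * A.card,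
        (rDiff A d : ℝ) ^ 2) :
    ∃ A' ⊆ A, (1 - ε) * K ^ (-(1 : ℝ) / 2) * A.card ≤ (A'.card : ℝ) ∧
      ((A' - A').card : ℝ) ≤ 2 ^ 33 * ε ^ (-(9 : ℤ)) * K ^ 4 * A'.card := by

  classical
  obtain ⟨hε0, hε2⟩ := hε
  have hK0 : 0 < K := by linarith
  have hn : (0 : ℝ) < A.card := by exact_mod_cast hA.card_pos
  set κ : ℝ := K ^ (-(1 : ℝ) / 2) with hκd
  have hκ : 0 < κ := Real.rpow_pos_of_pos hK0 _
  have hκ2 : κ ^ 2 * K = 1 := by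
    rw [hκd, ← Real.rpow_natCast, ← Real.rpow_mul hK0.le]
    norm_num [Real.rpow_neg_one]
    field_simp
  obtain ⟨k, D, hk, hD, hR1, hR2⟩ := exists_level A _ K ε κ hκ hκ2 hK hε0 hε2 hA
    (fun d hd => (mem_filter.1 hd).2) hQ
  have hsum := rDiff_sum A D
  set R : ℝ := ∑ d ∈ D, (rDiff A d : ℝ) with hRd
  set n : ℝ := (A.card : ℝ) with hnd
  have h12 : 0 < 1 - ε / 2 := by linarith
  have hRp : 0 < R := lt_of_lt_of_le (by positivity) hR1
  obtain ⟨A', hA', hc, hp⟩ := graph_lemma A D hA (R / n ^ 2) ε hε0 hε2 (by positivity)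
    (by rw [hsum, ← hnd]; field_simp)
  rw [← hnd] at hc hp
  have hS := path_count A D A' _ hp
  have hkp : (0 : ℝ) < k := by exact_mod_cast hk
  have hDk : (D.card : ℝ) * k ≤ R := by
    rw [hRd, ← nsmul_eq_mul]
    exact Finset.card_nsmul_le_sum _ _ _ fun d hd => by exact_mod_cast hD d hd
  have hcR : (3 / 4) * (R / n) ≤ A'.card := by
    refine le_trans ?_ hc
    have e : (1 - ε / 2) * (R / n ^ 2) * n = (1 - ε / 2) * (R / n) := by field_simp
    rw [e]
    gcongr; linarith
  refine ⟨A', hA', ?_, ?_⟩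
  · refine le_trans ?_ hc
    have e : (1 - ε / 2) * (R / n ^ 2) * n = (1 - ε / 2) * R / n := by field_simp
    rw [e, le_div_iff₀ hn]
    have h1 : (1 - ε / 2) * ((1 - ε / 2) * κ * n ^ 2) ≤ (1 - ε / 2) * R :=
      mul_le_mul_of_nonneg_left hR1 h12.le
    have h2 : 0 < κ * n ^ 2 := by positivity
    nlinarith [mul_pos h2 (mul_pos hε0 hε0)]
  · set s : ℝ := ((A' - A').card : ℝ) with hs
    have hs0 : 0 ≤ s := by positivity
    have h1 : s * (ε ^ 4 / 2 ^ 14 * (R / n ^ 2) ^ 5 * n ^ 3) * (k : ℝ) ^ 4 ≤ R ^ 4 := by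
      calc _ ≤ (D.card : ℝ) ^ 4 * (k : ℝ) ^ 4 := by gcongr
        _ = ((D.card : ℝ) * k) ^ 4 := by ring
        _ ≤ R ^ 4 := by gcongr
    have h2 : (ε ^ 2 / 256 * n ^ 4 / K ^ 2) ^ 2 ≤ (R * (k : ℝ) ^ 2) ^ 2 := by gcongr
    have h3 : s * (ε ^ 4 / 2 ^ 14 * n ^ 3 / n ^ 10 * R ^ 3) * (ε ^ 2 / 256 * n ^ 4 / K ^ 2) ^ 2
        ≤ R ^ 4 := by
      calc _ ≤ s * (ε ^ 4 / 2 ^ 14 * n ^ 3 / n ^ 10 * R ^ 3) * (R * (k : ℝ) ^ 2) ^ 2 := by gcongr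
        _ = s * (ε ^ 4 / 2 ^ 14 * (R / n ^ 2) ^ 5 * n ^ 3) * (k : ℝ) ^ 4 := by
          field_simp
        _ ≤ _ := h1
    have h4 : s * (ε ^ 8 / 2 ^ 30 / K ^ 4) ≤ R / n := by
      have e : s * (ε ^ 4 / 2 ^ 14 * n ^ 3 / n ^ 10 * R ^ 3) * (ε ^ 2 / 256 * n ^ 4 / K ^ 2) ^ 2
        = (s * (ε ^ 8 / 2 ^ 30 / K ^ 4)) * (R ^ 3 * n) := by
        field_simp; norm_num
      rw [e] at h3
      have e2 : R ^ 4 = (R / n) * (R ^ 3 * n) := by field_simp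
      rw [e2] at h3
      exact le_of_mul_le_mul_right h3 (by positivity)
    have h5 : s ≤ (2 ^ 30 * K ^ 4 / ε ^ 8) * (R / n) := by
      calc s = (2 ^ 30 * K ^ 4 / ε ^ 8) * (s * (ε ^ 8 / 2 ^ 30 / K ^ 4)) := by field_simp
        _ ≤ _ := by gcongr
    have h6 : R / n ≤ 2 * A'.card := by
      have : 0 < R / n := by positivity
      linarith
    have h7 : ε ^ (-(9 : ℤ)) = 1 / ε ^ 9 := by
      rw [zpow_neg, one_div]; norm_cast
    rw [h7]
    calc s ≤ (2 ^ 30 * K ^ 4 / ε ^ 8) * (2 * A'.card) := h5.trans (by gcongr)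
      _ = (ε * 2 ^ 31) * (1 / ε ^ 9) * K ^ 4 * A'.card := by field_simp
      _ ≤ 2 ^ 33 * (1 / ε ^ 9) * K ^ 4 * A'.card := by
        gcongr; linarith
end
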